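/- arXiv:2212.07122 — 3 statements merged into one kernel-verified Lean document; each statement's English description precedes it below -/
import Mathlib

section
/- Let 𝔞 be an ideal of R contained in its Jacobson radical and M a nonzero finitely generated R-module. Then M is 𝔞-relative Cohen-Macaulay if and only if cd(𝔞, R/𝔭) = grade(𝔞, M) for all 𝔭 ∈ Ass_R M. -/
open CategoryTheory Opposite
open scoped TensorProduct

universe u

variable (R : Type u) [CommRing R]

/-- The Ext module `Ext^i_R(R/a, M)` as an object of `ModuleCat R`. -/
noncomputable def relExt (a : Ideal R) (i : ℕ)
    (M : Type u) [AddCommGroup M] [Module R M] : ModuleCat R :=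
  ((Ext R (ModuleCat R) i).obj (op (ModuleCat.of R (R ⧸ a)))).obj (ModuleCat.of R M)

/-- `grade(a, M) = inf { i | Ext^i_R(R/a, M) ≠ 0 }`. -/
noncomputable def rgrade (a : Ideal R) (M : Type u) [AddCommGroup M] [Module R M] : ℕ :=
  sInf {i | Nontrivial (relExt R a i M)}

/-- The local cohomology module `H^i_a(M)` as an object of `ModuleCat R`. -/
noncomputable def localCoh (a : Ideal R) (i : ℕ)
    (M : Type u) [AddCommGroup M] [Module R M] : ModuleCat R :=
  (localCohomology a i).obj (ModuleCat.of R M)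

/-- `cd(a, M) = sup { i | H^i_a(M) ≠ 0 }` (cohomological dimension). -/
noncomputable def rcd (a : Ideal R) (M : Type u) [AddCommGroup M] [Module R M] : ℕ :=
  sSup {i | Nontrivial (localCoh R a i M)}

/-- `M` is `a`-relative Cohen-Macaulay: `M = aM`, or `M ≠ aM` and
`grade(a,M) = cd(a,M)`. -/
def IsRelCM (a : Ideal R) (M : Type u) [AddCommGroup M] [Module R M] : Prop :=
  (a • (⊤ : Submodule R M) = ⊤) ∨
    (a • (⊤ : Submodule R M) ≠ ⊤ ∧ rgrade R a M = rcd R a M)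

/-- `ara(a, M)`: the arithmetic rank of `a` with respect to `M`. -/
noncomputable def ara (a : Ideal R) (M : Type u) [AddCommGroup M] [Module R M] : ℕ :=
  sInf {n | ∃ x : Fin n → R,
    (Ideal.span (Set.range x) + Module.annihilator R M).radical
      = (a + Module.annihilator R M).radical}

/-- Projective dimension of `M`, characterized by Ext-vanishing, valued in `ℕ∞`. -/
noncomputable def rpd (M : Type u) [AddCommGroup M] [Module R M] : ℕ∞ :=
  sSup ((fun i : ℕ => (i : ℕ∞)) '' {i : ℕ | ∃ N : ModuleCat R,
    Nontrivial (((Ext R (ModuleCat R) i).obj (op (ModuleCat.of R M))).obj N)})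

/-- Injective dimension of `M`, characterized by Ext-vanishing, valued in `ℕ∞`. -/
noncomputable def rid (M : Type u) [AddCommGroup M] [Module R M] : ℕ∞ :=
  sSup ((fun i : ℕ => (i : ℕ∞)) '' {i : ℕ | ∃ N : ModuleCat R,
    Nontrivial (((Ext R (ModuleCat R) i).obj (op N)).obj (ModuleCat.of R M))})

/-- The `a`-relative injective dimension `a-id_R M = sup{i | Ext^i(R/a, M) ≠ 0}`,
valued in `ℕ∞`. -/
noncomputable def raid (a : Ideal R) (M : Type u) [AddCommGroup M] [Module R M] : ℕ∞ :=
  sSup ((fun i : ℕ => (i : ℕ∞)) '' {i : ℕ | Nontrivial (relExt R a i M)})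

/-- `μ(a)`: the minimal number of generators of the ideal `a`. -/
noncomputable def mu (a : Ideal R) : ℕ :=
  sInf {n | ∃ s : Finset R, s.card = n ∧ Ideal.span (↑s : Set R) = a}

/-- `R` is `a`-relative regular: `a` is generated by an `R`-regular sequence of
length `cd(a,R)`. -/
def IsRelRegularRing (a : Ideal R) : Prop :=
  ∃ rs : List R, RingTheory.Sequence.IsRegular R rs ∧ rs.length = rcd R a R ∧
    Ideal.ofList rs = a

/-- `M` is an `a`-relative regular module: `M = aM`, or `M ≠ aM` and `a` is generated by
a sequence of length `cd(a,R)` that is both an `M`-regular and an `R`-regular sequence. -/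
def IsRelRegularMod (a : Ideal R) (M : Type u) [AddCommGroup M] [Module R M] : Prop :=
  (a • (⊤ : Submodule R M) = ⊤) ∨
    (a • (⊤ : Submodule R M) ≠ ⊤ ∧ ∃ rs : List R, rs.length = rcd R a R ∧
      Ideal.ofList rs = a ∧ RingTheory.Sequence.IsRegular M rs ∧
      RingTheory.Sequence.IsRegular R rs)


namespace RCM
open CategoryTheory.Limits

variable {R}

section rep
variable (K : ChainComplex (ModuleCat.{u} R)ᵒᵖ ℕ) (n : ℕ)

def Rep (f : (K.X n).unop) (h : (K.homology n).unop) : Prop :=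
  ∃ z : (K.opcycles n).unop, (K.homologyι n).unop z = h ∧ (K.pOpcycles n).unop z = f

lemma rep_exists (h : (K.homology n).unop) : ∃ f, Rep K n f h := by
  have : Epi (K.homologyι n).unop := inferInstance
  obtain ⟨z, hz⟩ := (ModuleCat.epi_iff_surjective _).1 this h
  exact ⟨_, z, hz, rfl⟩

lemma rep_d {f : (K.X n).unop} {h} (H : Rep K n f h) : (K.d (n+1) n).unop f = 0 := by
  obtain ⟨z, -, rfl⟩ := H
  have : (K.pOpcycles n).unop ≫ (K.d (n+1) n).unop = 0 := by
    rw [← unop_comp, K.d_pOpcycles]; rfl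
  have := congrArg (fun g => g z) this
  simpa using this

lemma rep_exists' (f : (K.X n).unop) (hf : (K.d (n+1) n).unop f = 0) : ∃ h, Rep K n f h := by
  let φ : ModuleCat.of R R ⟶ (K.X n).unop := ModuleCat.ofHom (LinearMap.toSpanSingleton R _ f)
  have hφ : K.d (n+1) n ≫ φ.op = 0 := by
    apply Quiver.Hom.unop_inj
    ext
    simp [φ, hf]
  refine ⟨_, (K.descOpcycles φ.op (n+1) (by simp) hφ).unop (1 : R), rfl, ?_⟩
  have h := congrArg Quiver.Hom.unop (K.p_descOpcycles φ.op (n+1) (by simp) hφ)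
  have h := congrArg (fun g => g (1 : R)) h
  refine Eq.trans h ?_
  simp [φ]

lemma pOp_inj : Function.Injective (K.pOpcycles n).unop :=
  (ModuleCat.mono_iff_injective _).1 inferInstance

lemma rep_zero_succ (p : ℕ) (hp : p + 1 = n) {f : (K.X n).unop} {h} (H : Rep K n f h) :
    h = 0 ↔ ∃ g : (K.X p).unop, (K.d n p).unop g = f := by
  subst hp
  obtain ⟨z, rfl, rfl⟩ := H
  constructor
  · intro hz
    let S : ShortComplex (ModuleCat.{u} R)ᵒᵖ :=
      ShortComplex.mk _ _ (K.homologyι_comp_fromOpcycles (p+1) p)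
    have hS : S.Exact := S.exact_of_f_is_kernel (K.homologyIsKernel (p+1) p (by simp))
    have := (ShortComplex.moduleCat_exact_iff _).1 hS.unop z hz
    obtain ⟨g, hg⟩ := this
    refine ⟨g, ?_⟩
    rw [← hg]
    have := congrArg (fun g => g.unop) (K.p_fromOpcycles (p+1) p)
    rw [← this]; rfl
  · rintro ⟨g, hg⟩
    have h1 : z = (K.fromOpcycles (p+1) p).unop g := by
      apply pOp_inj
      rw [← hg]
      have := congrArg (fun g => g.unop) (K.p_fromOpcycles (p+1) p)
      rw [← this]; rfl
    rw [h1]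
    have := congrArg (fun g => g.unop) (K.homologyι_comp_fromOpcycles (p+1) p)
    exact congrArg (fun k => k g) this

lemma rep_zero_zero {f : (K.X 0).unop} {h} (H : Rep K 0 f h) :
    h = 0 ↔ f = 0 := by
  obtain ⟨z, rfl, rfl⟩ := H
  have h1 : Function.Injective (K.homologyι 0).unop :=
    (ModuleCat.mono_iff_injective _).1 inferInstance
  have h2 := pOp_inj K 0
  rw [map_eq_zero_iff _ h1, map_eq_zero_iff _ h2]

lemma rep_map {K L : ChainComplex (ModuleCat.{u} R)ᵒᵖ ℕ} {n : ℕ} (φ : K ⟶ L)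
    {f : (L.X n).unop} {h} (H : Rep L n f h) :
    Rep K n ((φ.f n).unop f) ((HomologicalComplex.homologyMap φ n).unop h) := by
  obtain ⟨z, rfl, rfl⟩ := H
  refine ⟨(HomologicalComplex.opcyclesMap φ n).unop z, ?_, ?_⟩
  · have := congrArg (fun g => g.unop) (HomologicalComplex.homologyι_naturality φ n)
    exact congrArg (fun k => k z) this.symm
  · have := congrArg (fun g => g.unop) (HomologicalComplex.p_opcyclesMap φ n)
    exact congrArg (fun k => k z) this
end rep


section cmp
variable {X Y : ModuleCat.{u} R}

noncomputable abbrev FY (Y : ModuleCat.{u} R) : ModuleCat.{u} R ⥤ (ModuleCat.{u} R)ᵒᵖ :=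
  ((linearYoneda R (ModuleCat.{u} R)).obj Y).rightOp

noncomputable abbrev KP (P : ProjectiveResolution X) (Y : ModuleCat.{u} R) :
    ChainComplex (ModuleCat.{u} R)ᵒᵖ ℕ :=
  ((FY Y).mapHomologicalComplex (ComplexShape.down ℕ)).obj P.complex

noncomputable abbrev OExt (X Y : ModuleCat.{u} R) (n : ℕ) : ModuleCat.{u} R :=
  (((FY Y).leftDerived n).obj X).unop

lemma oext_eq (X Y : ModuleCat.{u} R) (n : ℕ) :
    ((Ext R (ModuleCat R) n).obj (op X)).obj Y = OExt X Y n := rfl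

def Rel (n : ℕ) (P : ProjectiveResolution X) (f : P.complex.X n ⟶ Y) (h : OExt X Y n) : Prop :=
  Rep (KP P Y) n f ((P.isoLeftDerivedObj (FY Y) n).inv.unop h)

lemma kp_d (P : ProjectiveResolution X) (Y : ModuleCat.{u} R) (i j : ℕ) (f : P.complex.X j ⟶ Y) :
    ((KP P Y).d i j).unop f = P.complex.d i j ≫ f := rfl

lemma rel_exists (n : ℕ) (P : ProjectiveResolution X) (h : OExt X Y n) :
    ∃ f : P.complex.X n ⟶ Y, P.complex.d (n+1) n ≫ f = 0 ∧ Rel n P f h := by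
  obtain ⟨f, hf⟩ := rep_exists (KP P Y) n ((P.isoLeftDerivedObj (FY Y) n).inv.unop h)
  exact ⟨f, rep_d _ _ hf, hf⟩

lemma rel_exists' (n : ℕ) (P : ProjectiveResolution X) (f : P.complex.X n ⟶ Y)
    (hf : P.complex.d (n+1) n ≫ f = 0) : ∃ h : OExt X Y n, Rel n P f h := by
  obtain ⟨h, hh⟩ := rep_exists' (KP P Y) n f hf
  refine ⟨(P.isoLeftDerivedObj (FY Y) n).hom.unop h, ?_⟩
  have := congrArg Quiver.Hom.unop (P.isoLeftDerivedObj (FY Y) n).inv_hom_id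
  have e := congrArg (fun k => k h) this
  exact (congrArg (fun w => Rep (KP P Y) n f w) e).mpr hh

lemma rel_zero (n : ℕ) (P : ProjectiveResolution X) (f : P.complex.X n ⟶ Y)
    (hf : P.complex.d (n+1) n ≫ f = 0) (h : OExt X Y n) (H : Rel n P f h) :
    h = 0 ↔ P.extMk f (n+1) rfl hf = 0 := by
  have h0 : h = 0 ↔ (P.isoLeftDerivedObj (FY Y) n).inv.unop h = 0 := by
    rw [map_eq_zero_iff _ ((ModuleCat.mono_iff_injective _).1 inferInstance)]
  rw [h0]
  cases n with
  | zero =>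
    refine Iff.trans (rep_zero_zero _ H) ?_
    constructor
    · rintro rfl; exact P.extMk_zero (Y := Y) 1 rfl
    · intro h1
      simp only [ProjectiveResolution.extMk] at h1
      rw [← ProjectiveResolution.extEquivCohomologyClass_symm_zero,
        EmbeddingLike.apply_eq_iff_eq,
        CochainComplex.HomComplex.CohomologyClass.mk_eq_zero_iff,
        CochainComplex.HomComplex.Cocycle.toSingleMk_mem_coboundaries_iff _ _ _ _ _ 1 (by simp)] at h1
      obtain ⟨g, hg⟩ := h1
      have : P.cochainComplex.d (-(0:ℕ)) 1 = 0 := by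
        apply IsZero.eq_of_tgt
        exact CochainComplex.isZero_of_isStrictlyLE _ 0 1
      rw [this, zero_comp] at hg
      exact (cancel_epi (P.cochainComplexXIso (-(0:ℕ)) 0 rfl).hom).1 (hg.symm.trans comp_zero.symm)
  | succ p =>
    refine Iff.trans (rep_zero_succ _ _ p rfl H) ?_
    rw [P.extMk_eq_zero_iff f _ rfl hf p rfl]
    rfl

lemma rel_map {X' : ModuleCat.{u} R} (n : ℕ) (P : ProjectiveResolution X)
    (P' : ProjectiveResolution X') (g : X' ⟶ X) (φ : ProjectiveResolution.Hom P' P g)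
    (f : P.complex.X n ⟶ Y) (h : OExt X Y n) (H : Rel n P f h) :
    Rel n P' (φ.hom.f n ≫ f) ((((Ext R (ModuleCat R) n).map g.op).app Y) h) := by
  have := rep_map (((FY Y).mapHomologicalComplex (ComplexShape.down ℕ)).map φ.hom) H
  have e := ProjectiveResolution.isoLeftDerivedObj_inv_naturality g P' P φ.hom
    (by simpa using φ.hom_f_zero_comp_π_f_zero) (FY Y) n
  have e := congrArg Quiver.Hom.unop e
  have e := congrArg (fun k => k h) e
  exact (congrArg (fun w => Rep (KP P' Y) n (φ.hom.f n ≫ f) w) e).mpr this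

end cmp


abbrev AE (X Y : ModuleCat.{u} R) (n : ℕ) : Type u := CategoryTheory.Abelian.Ext.{u} X Y n

section van
variable (a : Ideal R)

def res {s t : ℕ} (h : t ≤ s) : ModuleCat.of R (R ⧸ a ^ s) ⟶ ModuleCat.of R (R ⧸ a ^ t) :=
  ModuleCat.ofHom (Submodule.mapQ (a ^ s) (a ^ t) LinearMap.id (Ideal.pow_le_pow_right h))

lemma res_comp {r s t : ℕ} (h : t ≤ s) (h' : s ≤ r) :
    res a h' ≫ res a h = res a (h.trans h') := by
  ext; rfl

/-- restriction of Ext classes -/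
noncomputable def rs {s t : ℕ} (h : t ≤ s) {A : ModuleCat.{u} R} {i : ℕ}
    (e : AE (ModuleCat.of R (R ⧸ a ^ t)) A i) : AE (ModuleCat.of R (R ⧸ a ^ s)) A i :=
  (CategoryTheory.Abelian.Ext.mk₀ (res a h)).comp e (zero_add i)

def HZero (i : ℕ) {A B : ModuleCat.{u} R} (φ : A ⟶ B) : Prop :=
  ∀ (t : ℕ) (e : AE (ModuleCat.of R (R ⧸ a ^ t)) A i), ∃ (s : ℕ) (h : t ≤ s),
    rs a h (e.comp (CategoryTheory.Abelian.Ext.mk₀ φ) (add_zero i)) = 0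

def Van (i : ℕ) (A : ModuleCat.{u} R) : Prop :=
  ∀ (t : ℕ) (e : AE (ModuleCat.of R (R ⧸ a ^ t)) A i), ∃ (s : ℕ) (h : t ≤ s), rs a h e = 0

lemma localCoh_sub_iff (i : ℕ) (Y : ModuleCat.{u} R) :
    Subsingleton ((localCohomology a i).obj Y) ↔
    ∀ (t : ℕ) (e : OExt (ModuleCat.of R (R ⧸ a ^ t)) Y i), ∃ (s : ℕ) (h : t ≤ s),
      (((Ext R (ModuleCat R) i).map (res a h).op).app Y) e = 0 := by
  let D := localCohomology.diagram (localCohomology.idealPowersDiagram a) i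
  let F : (ℕᵒᵖ)ᵒᵖ ⥤ ModuleCat.{u} R := D.flip.obj Y
  let iso : (localCohomology a i).obj Y ≅ colimit F := colimitObjIsoColimitCompEvaluation D Y
  have h1 : Subsingleton ((localCohomology a i).obj Y) ↔ Subsingleton (colimit F : ModuleCat R) :=
    (iso.toLinearEquiv.toEquiv).subsingleton_congr
  rw [h1]
  have hp : PreservesFilteredColimitsOfSize.{0, 0} (forget (ModuleCat.{u} R)) :=
    preservesFilteredColimitsOfSize_shrink.{0, u, 0, u} (forget (ModuleCat.{u} R))
  have hp' : PreservesColimit F (forget (ModuleCat.{u} R)) :=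
    (hp.preserves_filtered_colimits _).preservesColimit
  constructor
  · intro hs t e
    have : colimit.ι F (op (op t)) e = 0 := Subsingleton.elim _ _
    obtain ⟨j', w, hw⟩ := Concrete.colimit_rep_eq_zero.{u} R F (op (op t)) e this
    exact ⟨j'.unop.unop, w.unop.unop.down.down, hw⟩
  · intro H
    rw [subsingleton_iff_forall_eq 0]
    intro x
    obtain ⟨j, e, rfl⟩ := Concrete.colimit_exists_rep F x
    obtain ⟨s, h, hs⟩ := H j.unop.unop e
    let w : j ⟶ op (op s) := (homOfLE h).op.op
    rw [← colimit.w F w]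
    change colimit.ι F (op (op s)) (F.map w e) = 0
    have : F.map w e = 0 := hs
    rw [this, map_zero]

lemma ae_sub_iff (i : ℕ) (X Y : ModuleCat.{u} R) :
    Subsingleton (OExt X Y i) ↔ Subsingleton (AE X Y i) := by
  let P := projectiveResolution X
  rw [subsingleton_iff_forall_eq 0, subsingleton_iff_forall_eq 0]
  constructor
  · intro H e
    obtain ⟨f, hf, rfl⟩ := P.extMk_surjective e (i+1) rfl
    obtain ⟨h, hh⟩ := rel_exists' i P f hf
    exact (rel_zero i P f hf h hh).1 (H h)
  · intro H h
    obtain ⟨f, hf, hh⟩ := rel_exists i P h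
    exact (rel_zero i P f hf h hh).2 (H _)

lemma cmp_map (i : ℕ) {X X' : ModuleCat.{u} R} (Y : ModuleCat.{u} R) (e : OExt X Y i) (e' : AE X Y i)
    (P : ProjectiveResolution X) (f : P.complex.X i ⟶ Y)
    (hf : P.complex.d (i+1) i ≫ f = 0) (H : Rel i P f e) (he : P.extMk f (i+1) rfl hf = e')
    (g : X' ⟶ X) :
    (((Ext R (ModuleCat R) i).map g.op).app Y) e = 0 ↔
      (CategoryTheory.Abelian.Ext.mk₀ g).comp e' (zero_add i) = 0 := by
  let P' := projectiveResolution X'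
  let φ : ProjectiveResolution.Hom P' P g :=
    ⟨ProjectiveResolution.lift g P' P, by
      rw [← HomologicalComplex.comp_f, ProjectiveResolution.lift_commutes]; rfl⟩
  have := rel_map i P P' g φ f e H
  refine (rel_zero i P' _ (by simp [← φ.hom.comm_assoc, hf]) _ this).trans ?_
  rw [← he, P.mk₀_comp_extMk f _ rfl hf φ]

lemma van_iff (i : ℕ) (Y : ModuleCat.{u} R) :
    Subsingleton ((localCohomology a i).obj Y) ↔ Van a i Y := by
  rw [localCoh_sub_iff]
  constructor
  · intro H t e
    let P := projectiveResolution (ModuleCat.of R (R ⧸ a ^ t))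
    obtain ⟨f, hf, he⟩ := P.extMk_surjective e (i+1) rfl
    obtain ⟨h, hh⟩ := rel_exists' i P f hf
    obtain ⟨s, hs, h0⟩ := H t h
    exact ⟨s, hs, (cmp_map i Y h e P f hf hh he _).1 h0⟩
  · intro H t h
    let P := projectiveResolution (ModuleCat.of R (R ⧸ a ^ t))
    obtain ⟨f, hf, hh⟩ := rel_exists i P h
    obtain ⟨s, hs, h0⟩ := H t (P.extMk f (i+1) rfl hf)
    exact ⟨s, hs, (cmp_map i Y h _ P f hf hh rfl _).2 h0⟩
end van


section chase
open CategoryTheory.Abelian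
variable (a : Ideal R)

lemma rs_comp {s t : ℕ} (h : t ≤ s) {A B : ModuleCat.{u} R} {i j n : ℕ}
    (e : AE (ModuleCat.of R (R ⧸ a ^ t)) A i) (x : AE A B j) (hn : i + j = n) :
    rs a h (e.comp x hn) = (rs a h e).comp x hn := by
  unfold rs
  rw [Ext.comp_assoc _ _ _ (zero_add i) hn (by lia)]

lemma rs_rs {r s t : ℕ} (h : t ≤ s) (h' : s ≤ r) {A : ModuleCat.{u} R} {i : ℕ}
    (e : AE (ModuleCat.of R (R ⧸ a ^ t)) A i) :
    rs a h' (rs a h e) = rs a (h.trans h') e := by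
  unfold rs
  rw [Ext.mk₀_comp_mk₀_assoc, res_comp]

@[simp] lemma rs_zero {s t : ℕ} (h : t ≤ s) {A : ModuleCat.{u} R} {i : ℕ} :
    rs a h (0 : AE (ModuleCat.of R (R ⧸ a ^ t)) A i) = 0 := by
  unfold rs; simp

lemma hzero_of_van_left {i : ℕ} {A B : ModuleCat.{u} R} (φ : A ⟶ B) (h : Van a i A) :
    HZero a i φ := by
  intro t e
  obtain ⟨s, hs, h0⟩ := h t e
  exact ⟨s, hs, by rw [rs_comp, h0]; simp⟩

lemma hzero_of_van_right {i : ℕ} {A B : ModuleCat.{u} R} (φ : A ⟶ B) (h : Van a i B) :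
    HZero a i φ := by
  intro t e
  exact h t _

lemma hzero_comp {i : ℕ} {A B C : ModuleCat.{u} R} (φ : A ⟶ B) (ψ : B ⟶ C) (h : HZero a i φ) :
    HZero a i (φ ≫ ψ) := by
  intro t e
  obtain ⟨s, hs, h0⟩ := h t e
  refine ⟨s, hs, ?_⟩
  rw [← Ext.mk₀_comp_mk₀, ← Ext.comp_assoc_of_third_deg_zero, rs_comp, h0]
  simp

lemma van_of_retract {i : ℕ} {A B : ModuleCat.{u} R} (φ : A ⟶ B) (ψ : B ⟶ A) (h : φ ≫ ψ = 𝟙 A)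
    (hB : Van a i B) : Van a i A := by
  have := hzero_comp a φ ψ (hzero_of_van_right a φ hB)
  rw [h] at this
  intro t e
  simpa using this t e

variable {S : ShortComplex (ModuleCat.{u} R)} (hS : S.ShortExact)
include hS

lemma van_mid' {i : ℕ} (h1 : Van a i S.X₁) (h3 : Van a i S.X₃) : Van a i S.X₂ := by
  intro t e
  obtain ⟨s, hs, h0⟩ := h3 t (e.comp (Ext.mk₀ S.g) (add_zero i))
  rw [rs_comp] at h0
  obtain ⟨e1, he1⟩ := Ext.covariant_sequence_exact₂ _ hS _ h0
  obtain ⟨r, hr, h0⟩ := h1 s e1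
  refine ⟨r, hs.trans hr, ?_⟩
  rw [← rs_rs a hs hr, ← he1, rs_comp, h0]; simp

lemma van_right' {i j : ℕ} (hj : i + 1 = j) (h2 : Van a i S.X₂) (h1 : Van a j S.X₁) :
    Van a i S.X₃ := by
  intro t e
  obtain ⟨s, hs, h0⟩ := h1 t (e.comp hS.extClass hj)
  rw [rs_comp] at h0
  obtain ⟨e1, he1⟩ := Ext.covariant_sequence_exact₃ _ hS _ hj h0
  obtain ⟨r, hr, h0⟩ := h2 s e1
  refine ⟨r, hs.trans hr, ?_⟩
  rw [← rs_rs a hs hr, ← he1, rs_comp, h0]; simp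

lemma van_left' {i j : ℕ} (hj : i + 1 = j) (h3 : Van a i S.X₃) (h2 : Van a j S.X₂) :
    Van a j S.X₁ := by
  intro t e
  obtain ⟨s, hs, h0⟩ := h2 t (e.comp (Ext.mk₀ S.f) (add_zero j))
  rw [rs_comp] at h0
  obtain ⟨e1, he1⟩ := Ext.covariant_sequence_exact₁ _ hS _ h0 hj
  obtain ⟨r, hr, h0⟩ := h3 s e1
  refine ⟨r, hs.trans hr, ?_⟩
  rw [← rs_rs a hs hr, ← he1, rs_comp, h0]; simp

end chase

section typed
open CategoryTheory.Abelian
variable (a : Ideal R)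

abbrev VN (i : ℕ) (N : Type u) [AddCommGroup N] [Module R N] : Prop := Van a i (ModuleCat.of R N)

variable {A B C : Type u} [AddCommGroup A] [Module R A] [AddCommGroup B] [Module R B]
  [AddCommGroup C] [Module R C]

lemma vn_equiv {i : ℕ} (e : A ≃ₗ[R] B) (h : VN a i B) : VN a i A :=
  van_of_retract a (ModuleCat.ofHom e.toLinearMap) (ModuleCat.ofHom e.symm.toLinearMap)
    (by ext; simp) h

abbrev sc (f : A →ₗ[R] B) (g : B →ₗ[R] C) (hfg : Function.Exact f g) :
    ShortComplex (ModuleCat.{u} R) :=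
  ShortComplex.mk (ModuleCat.ofHom f) (ModuleCat.ofHom g) (by ext x; exact hfg.apply_apply_eq_zero x)

lemma sc_exact (f : A →ₗ[R] B) (g : B →ₗ[R] C) (hfg : Function.Exact f g)
    (hf : Function.Injective f) (hg : Function.Surjective g) : (sc f g hfg).ShortExact where
  exact := (ShortComplex.ShortExact.moduleCat_exact_iff_function_exact _).2 hfg
  mono_f := (ModuleCat.mono_iff_injective _).2 hf
  epi_g := (ModuleCat.epi_iff_surjective _).2 hg

variable (f : A →ₗ[R] B) (g : B →ₗ[R] C) (hfg : Function.Exact f g)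
    (hf : Function.Injective f) (hg : Function.Surjective g)
include hfg hf hg

lemma vn_mid {i : ℕ} (h1 : VN a i A) (h3 : VN a i C) : VN a i B :=
  van_mid' a (sc_exact f g hfg hf hg) h1 h3

lemma vn_right {i : ℕ} (h2 : VN a i B) (h1 : VN a (i+1) A) : VN a i C :=
  van_right' a (sc_exact f g hfg hf hg) rfl h2 h1

lemma vn_left {i : ℕ} (h3 : VN a i C) (h2 : VN a (i+1) B) : VN a (i+1) A :=
  van_left' a (sc_exact f g hfg hf hg) rfl h3 h2

end typed

section sub
variable (a : Ideal R) {N : Type u} [AddCommGroup N] [Module R N]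

lemma vn_sub_mid (P : Submodule R N) {i : ℕ} (h1 : VN a i P) (h3 : VN a i (N ⧸ P)) : VN a i N :=
  vn_mid a P.subtype P.mkQ (LinearMap.exact_subtype_mkQ P) P.subtype_injective P.mkQ_surjective h1 h3

lemma vn_subsingleton [Subsingleton N] (i : ℕ) : VN a i N := by
  intro t e
  refine ⟨t, le_rfl, ?_⟩
  have : e = 0 := by
    rw [← Abelian.Ext.comp_mk₀_id e]
    have : 𝟙 (ModuleCat.of R N) = 0 := by ext; exact Subsingleton.elim _ _
    rw [this]; simp
  rw [this]; simp
end sub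


section tors
open CategoryTheory.Abelian
variable (a : Ideal R)

def ATors (N : Type u) [AddCommGroup N] [Module R N] : Prop :=
  ∀ n : N, ∃ k : ℕ, ∀ r ∈ a ^ k, r • n = 0

def Gam (N : Type u) [AddCommGroup N] [Module R N] : Submodule R N where
  carrier := {n | ∃ k : ℕ, ∀ r ∈ a ^ k, r • n = 0}
  zero_mem' := ⟨0, by simp⟩
  add_mem' := by
    rintro x y ⟨k, hk⟩ ⟨l, hl⟩
    refine ⟨k + l, fun r hr => ?_⟩
    rw [smul_add, hk r (Ideal.pow_le_pow_right (by lia) hr),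
      hl r (Ideal.pow_le_pow_right (by lia) hr), add_zero]
  smul_mem' := by
    rintro c x ⟨k, hk⟩
    exact ⟨k, fun r hr => by rw [smul_comm, hk r hr, smul_zero]⟩

lemma gam_tors (N : Type u) [AddCommGroup N] [Module R N] : ATors a (Gam a N) := by
  rintro ⟨n, k, hk⟩
  exact ⟨k, fun r hr => Subtype.ext (hk r hr)⟩

lemma ATors.of_surj {N N' : Type u} [AddCommGroup N] [Module R N] [AddCommGroup N'] [Module R N']
    (f : N →ₗ[R] N') (hf : Function.Surjective f) (h : ATors a N) : ATors a N' := by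
  intro y
  obtain ⟨x, rfl⟩ := hf y
  obtain ⟨k, hk⟩ := h x
  exact ⟨k, fun r hr => by rw [← map_smul, hk r hr, map_zero]⟩

lemma fg_kill {N : Type u} [AddCommGroup N] [Module R N] [Module.Finite R N] (h : ATors a N) :
    ∃ k : ℕ, ∀ r ∈ a ^ k, ∀ n : N, r • n = 0 := by
  obtain ⟨s, hs⟩ := (Module.Finite.fg_top : (⊤ : Submodule R N).FG)
  choose k hk using h
  refine ⟨s.sup k, fun r hr n => ?_⟩
  have hn : n ∈ Submodule.span R (s : Set N) := hs ▸ Submodule.mem_top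
  induction hn using Submodule.span_induction with
  | mem x hx => exact hk x r (Ideal.pow_le_pow_right (Finset.le_sup hx) hr)
  | zero => simp
  | add x y _ _ hx hy => rw [smul_add, hx, hy, add_zero]
  | smul c x _ hx => rw [smul_comm, hx, smul_zero]

lemma gam_inj [IsNoetherianRing R] (E : Type u) [AddCommGroup E] [Module R E]
    [hE : Module.Injective R E] : Module.Injective R (Gam a E) := by
  apply Module.Baer.injective
  intro I g
  obtain ⟨k, hk⟩ : ∃ k : ℕ, ∀ r ∈ a ^ k, ∀ x : I, r • g x = 0 := by
    have ht : ATors a (LinearMap.range g) := by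
      rintro ⟨x, hx⟩
      obtain ⟨k, hk⟩ := gam_tors a E x
      exact ⟨k, fun r hr => Subtype.ext (hk r hr)⟩
    obtain ⟨k, hk⟩ := fg_kill a ht
    exact ⟨k, fun r hr x => by simpa using congrArg Subtype.val (hk r hr ⟨g x, x, rfl⟩)⟩
  obtain ⟨c, hc⟩ := Ideal.exists_pow_inf_eq_pow_smul a (M := R) I
  have hc := hc (k + c) (by lia)
  have hle : a ^ (k + c) ⊓ I ≤ a ^ k * I := by
    intro x hx
    have : x ∈ a ^ (k + c) • (⊤ : Submodule R R) ⊓ I := by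
      simpa using hx
    rw [hc] at this
    have h2 : k + c - c = k := by lia
    rw [h2] at this
    exact Ideal.mul_mono_right inf_le_right this
  let f : I →ₗ[R] R ⧸ a ^ (k + c) := (Submodule.mkQ (a ^ (k+c))) ∘ₗ I.subtype
  let g' : I →ₗ[R] E := (Gam a E).subtype ∘ₗ g
  have hker : LinearMap.ker f ≤ LinearMap.ker g' := by
    intro x hx
    have hx1 : (x : R) ∈ a ^ (k + c) := by
      exact Ideal.Quotient.eq_zero_iff_mem.1 (by simpa [f] using hx)
    have hx2 : (x : R) ∈ a ^ k * I := hle ⟨hx1, x.2⟩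
    have : ∀ y ∈ a ^ k * I, ∃ hy : y ∈ I, g' ⟨y, hy⟩ = 0 := by
      intro y hy
      refine Submodule.mul_induction_on hy ?_ ?_
      · intro m hm n hn
        refine ⟨I.mul_mem_left m hn, ?_⟩
        have e : (⟨m * n, I.mul_mem_left m hn⟩ : I) = m • ⟨n, hn⟩ := rfl
        rw [e, map_smul]
        exact congrArg Subtype.val (hk m hm ⟨n, hn⟩)
      · rintro x y ⟨hx, hx'⟩ ⟨hy, hy'⟩
        refine ⟨I.add_mem hx hy, ?_⟩
        have e : (⟨x + y, I.add_mem hx hy⟩ : I) = ⟨x, hx⟩ + ⟨y, hy⟩ := rfl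
        rw [e, map_add, hx', hy', add_zero]
    exact (this _ hx2).2
  let f1 := (LinearMap.ker f).liftQ f le_rfl
  let g1 := (LinearMap.ker f).liftQ g' hker
  have hf1 : Function.Injective f1 := by
    rw [← LinearMap.ker_eq_bot]
    exact Submodule.ker_liftQ_eq_bot _ _ _ le_rfl
  obtain ⟨h, hh⟩ := hE.out f1 hf1 g1
  refine ⟨LinearMap.toSpanSingleton R _ ⟨h (Submodule.Quotient.mk 1), k + c, fun r hr => ?_⟩, ?_⟩
  · rw [← map_smul, ← Submodule.Quotient.mk_smul, smul_eq_mul, mul_one,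
      (Submodule.Quotient.mk_eq_zero _).2 hr, map_zero]
  · intro x hx
    apply Subtype.ext
    have := hh (Submodule.Quotient.mk ⟨x, hx⟩)
    simp only [f1, g1, Submodule.liftQ_apply] at this
    change x • h (Submodule.Quotient.mk 1) = g' ⟨x, hx⟩
    rw [← this, ← map_smul, ← Submodule.Quotient.mk_smul, smul_eq_mul, mul_one]
    rfl

lemma van_inj (E : Type u) [AddCommGroup E] [Module R E]
    [hE : Module.Injective R E] (i : ℕ) : VN a (i+1) E := by
  intro t e
  have := Module.injective_object_of_injective_module R E
  refine ⟨t, le_rfl, ?_⟩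
  rw [Ext.eq_zero_of_injective e, rs_zero]

lemma tors_van [IsNoetherianRing R] (i : ℕ) : ∀ (N : Type u) [AddCommGroup N] [Module R N],
    ATors a N → VN a (i+1) N := by
  induction i with
  | zero =>
    intro N _ _ hN
    obtain ⟨E, hE, j, hj⟩ := EnoughInjectives.presentation (ModuleCat.of R N)
    have : Module.Injective R E := Module.injective_module_of_injective_object R E
    have hj' : Function.Injective j := (ModuleCat.mono_iff_injective _).1 hj
    have := gam_inj a E
    let f : N →ₗ[R] Gam a E := j.hom.codRestrict _ (fun n => by
      obtain ⟨k, hk⟩ := hN n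
      exact ⟨k, fun r hr => by rw [← map_smul, hk r hr, map_zero]⟩)
    have hf : Function.Injective f := fun x y h => hj' (congrArg Subtype.val h)
    let g := (LinearMap.range f).mkQ
    have hfg : Function.Exact f g := LinearMap.exact_map_mkQ_range f
    have hg : Function.Surjective g := Submodule.mkQ_surjective _
    have hS := sc_exact f g hfg hf hg
    intro t e
    have := Module.injective_object_of_injective_module R (Gam a E)
    obtain ⟨x, hx⟩ := Ext.covariant_sequence_exact₁ _ hS e (Ext.eq_zero_of_injective _)
      (n₀ := 0) rfl
    obtain ⟨φ, rfl⟩ := Ext.homEquiv₀.symm.surjective x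
    obtain ⟨c, hc⟩ := hg (φ (Submodule.Quotient.mk 1))
    obtain ⟨s, hs⟩ := gam_tors a E c
    refine ⟨max s t, le_max_right _ _, ?_⟩
    let ψ : (R ⧸ a ^ (max s t)) →ₗ[R] Gam a E :=
      Submodule.liftQ _ (LinearMap.toSpanSingleton R _ c) (fun r hr =>
        LinearMap.mem_ker.2 (hs r (Ideal.pow_le_pow_right (le_max_left _ _) hr)))
    have hψ : res a (le_max_right s t) ≫ φ = ModuleCat.ofHom ψ ≫ ModuleCat.ofHom g := by
      ext
      simp only [ModuleCat.hom_comp, ModuleCat.hom_ofHom]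
      change φ.hom (Submodule.Quotient.mk 1) = g (ψ (Submodule.Quotient.mk 1))
      simp only [ψ, Submodule.liftQ_apply, LinearMap.toSpanSingleton_apply, one_smul]
      exact hc.symm
    rw [← hx, rs_comp]
    have h3 : rs a (le_max_right s t) (Ext.homEquiv₀.symm φ) =
        (Ext.mk₀ (ModuleCat.ofHom ψ)).comp (Ext.mk₀ (ModuleCat.ofHom g)) (zero_add 0) := by
      unfold rs
      rw [Ext.homEquiv₀_symm_apply, Ext.mk₀_comp_mk₀, Ext.mk₀_comp_mk₀, hψ]
    rw [h3, Ext.comp_assoc _ _ _ (zero_add 0) (zero_add 1) (by rfl)]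
    have := hS.comp_extClass
    simp only [sc] at this
    rw [this, Ext.comp_zero]
  | succ i ih =>
    intro N _ _ hN
    obtain ⟨E, hE, j, hj⟩ := EnoughInjectives.presentation (ModuleCat.of R N)
    have : Module.Injective R E := Module.injective_module_of_injective_object R E
    have hj' : Function.Injective j := (ModuleCat.mono_iff_injective _).1 hj
    have := gam_inj a E
    let f : N →ₗ[R] Gam a E := j.hom.codRestrict _ (fun n => by
      obtain ⟨k, hk⟩ := hN n
      exact ⟨k, fun r hr => by rw [← map_smul, hk r hr, map_zero]⟩)
    have hf : Function.Injective f := fun x y h => hj' (congrArg Subtype.val h)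
    exact vn_left a f (LinearMap.range f).mkQ (LinearMap.exact_map_mkQ_range f) hf
      (Submodule.mkQ_surjective _)
      (ih _ (ATors.of_surj a _ (Submodule.mkQ_surjective _) (gam_tors a E)))
      (van_inj a _ _)
end tors


section gens
open CategoryTheory.Abelian
variable (a : Ideal R)

lemma van_of_bij {x : R} (hx : x ∈ a) (N : Type u) [AddCommGroup N] [Module R N]
    (h : Function.Bijective (fun n : N => x • n)) (i : ℕ) : VN a i N := by
  intro t e
  refine ⟨t, le_rfl, ?_⟩
  have hb : Function.Bijective (LinearMap.lsmul R N (x ^ t)) := by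
    have : ⇑(LinearMap.lsmul R N (x ^ t)) = (fun n : N => x • n)^[t] := by
      ext n
      rw [smul_iterate]; rfl
    rw [this]
    exact h.iterate t
  let μ := LinearEquiv.ofBijective _ hb
  have h1 : e.comp (Ext.mk₀ (ModuleCat.ofHom μ.toLinearMap)) (add_zero i) = 0 := by
    have : ModuleCat.ofHom μ.toLinearMap = x ^ t • 𝟙 (ModuleCat.of R N) := by
      ext n; rfl
    rw [this, Ext.mk₀_smul, Ext.comp_smul, Ext.comp_mk₀_id, ← Ext.mk₀_id_comp e,
      ← Ext.smul_comp, ← Ext.mk₀_smul]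
    have : x ^ t • 𝟙 (ModuleCat.of R (R ⧸ a ^ t)) = 0 := by
      ext
      change (Ideal.Quotient.mk (a ^ t)) (x ^ t * 1) = 0
      rw [Ideal.Quotient.eq_zero_iff_mem, mul_one]
      exact Ideal.pow_mem_pow hx t
    rw [this]; simp
  have h2 : e = 0 := by
    have h3 : ModuleCat.ofHom μ.toLinearMap ≫ ModuleCat.ofHom μ.symm.toLinearMap =
      𝟙 (ModuleCat.of R N) := by ext; simp
    rw [← Ext.comp_mk₀_id e, ← h3, ← Ext.mk₀_comp_mk₀, ← Ext.comp_assoc_of_third_deg_zero, h1]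
    simp
  rw [h2, rs_zero]

def XT (x : R) (N : Type u) [AddCommGroup N] [Module R N] : Prop :=
  ∀ n : N, ∃ k : ℕ, x ^ k • n = 0

def GX (x : R) (N : Type u) [AddCommGroup N] [Module R N] : Submodule R N where
  carrier := {n | ∃ k : ℕ, x ^ k • n = 0}
  zero_mem' := ⟨0, by simp⟩
  add_mem' := by
    rintro m n ⟨k, hk⟩ ⟨l, hl⟩
    refine ⟨k + l, ?_⟩
    rw [smul_add, pow_add, mul_comm, mul_smul, hk, smul_zero, mul_comm, mul_smul, hl, smul_zero,
      add_zero]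
  smul_mem' := by
    rintro c m ⟨k, hk⟩
    exact ⟨k, by rw [smul_comm, hk, smul_zero]⟩

lemma XT.of_surj {x : R} {N N' : Type u} [AddCommGroup N] [Module R N] [AddCommGroup N'] [Module R N']
    (f : N →ₗ[R] N') (hf : Function.Surjective f) (h : XT x N) : XT x N' := by
  intro y
  obtain ⟨n, rfl⟩ := hf y
  obtain ⟨k, hk⟩ := h n
  exact ⟨k, by rw [← map_smul, hk, map_zero]⟩

lemma ators_of_xt (T : Finset R) (hT : Ideal.span (T : Set R) = a) (N : Type u) [AddCommGroup N]
    [Module R N] (h : ∀ y ∈ T, XT y N) : ATors a N := by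
  intro n
  obtain ⟨k, hk⟩ := Ideal.exists_pow_le_of_le_radical_of_fg (I := a)
    (J := LinearMap.ker (LinearMap.toSpanSingleton R N n)) (by
      rw [← hT, Ideal.span_le]
      intro y hy
      obtain ⟨k, hk⟩ := h y hy n
      exact ⟨k, hk⟩) ⟨T, hT⟩
  exact ⟨k, fun r hr => hk hr⟩

lemma van_gens [IsNoetherianRing R] (T : Finset R) (hT : Ideal.span (T : Set R) = a)
    (U : Finset R) (hU : U ⊆ T) : ∀ (N : Type u) [AddCommGroup N] [Module R N],
    (∀ y ∈ T, y ∉ U → XT y N) → ∀ i, U.card < i → VN a i N := by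
  classical
  induction U using Finset.induction_on with
  | empty =>
    intro N _ _ h i hi
    obtain ⟨j, rfl⟩ : ∃ j, i = j + 1 := ⟨i - 1, by simp at hi; lia⟩
    exact tors_van a j N (ators_of_xt a T hT N (fun y hy => h y hy (by simp)))
  | insert x U hxU ih =>
    have ih := ih (fun y hy => hU (Finset.mem_insert_of_mem hy))
    intro N _ _ h i hi
    rw [Finset.card_insert_of_notMem hxU] at hi
    have hxT : x ∈ T := hU (Finset.mem_insert_self x U)
    have hxa : x ∈ a := hT ▸ Ideal.subset_span hxT
    apply vn_sub_mid a (GX x N)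
    · apply ih _ _ i (by lia)
      rintro y hy hyU ⟨n, hn⟩
      by_cases hyx : y = x
      · subst hyx
        obtain ⟨k, hk⟩ := hn
        exact ⟨k, Subtype.ext hk⟩
      · obtain ⟨k, hk⟩ := h y hy (by simp [hyx, hyU]) n
        exact ⟨k, Subtype.ext hk⟩
    · let N' := N ⧸ GX x N
      have hN' : ∀ n : N', ∀ k : ℕ, x ^ k • n = 0 → n = 0 := by
        intro n k hk
        obtain ⟨n, rfl⟩ := Submodule.mkQ_surjective _ n
        rw [← map_smul, Submodule.mkQ_apply, Submodule.Quotient.mk_eq_zero] at hk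
        obtain ⟨l, hl⟩ := hk
        rw [Submodule.mkQ_apply, Submodule.Quotient.mk_eq_zero]
        exact ⟨l + k, by rw [pow_add, mul_smul, hl]⟩
      have hyN' : ∀ y ∈ T, y ∉ insert x U → XT y N' := fun y hy hyU =>
        XT.of_surj _ (Submodule.mkQ_surjective _) (h y hy hyU)
      let L := LocalizedModule (Submonoid.powers x) N'
      let f : N' →ₗ[R] L := LocalizedModule.mkLinearMap (Submonoid.powers x) N'
      have hf : Function.Injective f := by
        rw [← LinearMap.ker_eq_bot, LinearMap.ker_eq_bot']
        intro n hn
        obtain ⟨⟨_, k, rfl⟩, hk⟩ := (IsLocalizedModule.eq_zero_iff (Submonoid.powers x) f).1 hn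
        exact hN' n k hk
      have hfs : ∀ l : L, ∃ k n, x ^ k • l = f n := by
        intro l
        obtain ⟨⟨n, ⟨_, k, rfl⟩⟩, hk⟩ := IsLocalizedModule.surj (Submonoid.powers x) f l
        exact ⟨k, n, hk⟩
      have hbij : Function.Bijective (fun l : L => x • l) :=
        (Module.End.isUnit_iff _).1 (IsLocalizedModule.map_units f (⟨x, 1, pow_one x⟩ : Submonoid.powers x))
      obtain ⟨j, rfl⟩ : ∃ j, i = j + 1 := ⟨i - 1, by lia⟩
      refine vn_left a f (LinearMap.range f).mkQ (LinearMap.exact_map_mkQ_range f) hf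
        (Submodule.mkQ_surjective _) (ih _ ?_ j (by lia)) (van_of_bij a hxa L hbij _)
      intro y hy hyU
      by_cases hyx : y = x
      · subst hyx
        intro c
        obtain ⟨l, rfl⟩ := Submodule.mkQ_surjective _ c
        obtain ⟨k, n, hk⟩ := hfs l
        refine ⟨k, ?_⟩
        rw [← map_smul, hk, Submodule.mkQ_apply, Submodule.Quotient.mk_eq_zero]
        exact ⟨n, rfl⟩
      · refine XT.of_surj _ (Submodule.mkQ_surjective _) ?_
        intro l
        obtain ⟨k, n, hk⟩ := hfs l
        obtain ⟨m, hm⟩ := hyN' y hy (by simp [hyx, hyU]) n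
        refine ⟨m, ?_⟩
        have h1 : x ^ k • (y ^ m • l) = 0 := by
          rw [smul_comm, hk, ← map_smul, hm, map_zero]
        have h2 : Function.Injective (fun n : L => x • n)^[k] := hbij.1.iterate k
        rw [smul_iterate] at h2
        exact h2 (by simpa using h1)

lemma exists_bound [IsNoetherianRing R] : ∃ b : ℕ, ∀ (N : Type u) [AddCommGroup N] [Module R N],
    ∀ i, b < i → VN a i N := by
  obtain ⟨T, hT⟩ := IsNoetherian.noetherian a
  exact ⟨T.card, fun N _ _ i hi =>
    van_gens a T hT T (Finset.Subset.refl _) N (fun y hy h => absurd hy h) i hi⟩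
end gens


section dnt
variable (a : Ideal R)

lemma mem_supp_quot (I : Ideal R) (p : PrimeSpectrum R) :
    p ∈ Module.support R (R ⧸ I) ↔ I ≤ p.asIdeal := by
  rw [Module.mem_support_iff_of_finite, Ideal.annihilator_quotient]

lemma vn_filt [IsNoetherianRing R] (j : ℕ) (S : Set (PrimeSpectrum R))
    (h : ∀ p ∈ S, VN a j (R ⧸ p.asIdeal))
    (N : Type u) [AddCommGroup N] [Module R N] [hN : Module.Finite R N]
    (hs : Module.support R N ⊆ S) : VN a j N := by
  refine IsNoetherianRing.induction_on_isQuotientEquivQuotientPrime R hN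
    (motive := fun N _ _ _ => Module.support R N ⊆ S → VN a j N) ?_ ?_ ?_ hs
  · intro N _ _ _ _ _
    exact vn_subsingleton a j
  · intro N _ _ _ p e hs
    refine vn_equiv a e (h p (hs ?_))
    rw [e.support_eq, mem_supp_quot]
  · intro N1 _ _ _ N2 _ _ _ N3 _ _ _ f g hf hg hfg h1 h3 hs
    rw [Module.support_of_exact hfg hf hg] at hs
    exact vn_mid a f g hfg hf hg (h1 (Set.subset_union_left.trans hs))
      (h3 (Set.subset_union_right.trans hs))

lemma exists_hom [IsNoetherianRing R] (M : Type u) [AddCommGroup M] [Module R M] [Module.Finite R M]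
    (q : PrimeSpectrum R) (hq : q ∈ Module.support R M) :
    ∃ φ : M →ₗ[R] (R ⧸ q.asIdeal), φ ≠ 0 := by
  by_contra! hh
  have : Subsingleton (M →ₗ[R] (R ⧸ q.asIdeal)) :=
    ⟨fun x y => by rw [hh x, hh y]⟩
  obtain ⟨r, hr, hreg⟩ := IsSMulRegular.subsingleton_linearMap_iff.1 this
  have hrq := Module.annihilator_le_of_mem_support hq hr
  have h0 : ∀ x : R ⧸ q.asIdeal, r • x = 0 := by
    intro x
    obtain ⟨x, rfl⟩ := Ideal.Quotient.mk_surjective x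
    change Ideal.Quotient.mk _ (r * x) = 0
    rw [Ideal.Quotient.eq_zero_iff_mem]
    exact q.asIdeal.mul_mem_right _ hrq
  have : (1 : R ⧸ q.asIdeal) = 0 := hreg (by simp only [h0])
  exact one_ne_zero this

lemma dnt_step [IsNoetherianRing R] (M : Type u) [AddCommGroup M] [Module R M] [Module.Finite R M]
    (j : ℕ) (hM : VN a j M)
    (hj : ∀ (N : Type u) [AddCommGroup N] [Module R N] [Module.Finite R N],
      Module.support R N ⊆ Module.support R M → VN a (j+1) N) (I : Ideal R) :
    ∀ (hI : I.IsPrime), (⟨I, hI⟩ : PrimeSpectrum R) ∈ Module.support R M → VN a j (R ⧸ I) := by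
  induction I using WellFoundedGT.induction with
  | ind I ih =>
    intro hI hs
    obtain ⟨φ, hφ⟩ := exists_hom M ⟨I, hI⟩ hs
    let W := LinearMap.range φ
    have hW : VN a j W := by
      refine vn_right a (LinearMap.ker φ).subtype φ.rangeRestrict ?_ (Submodule.subtype_injective _)
        φ.surjective_rangeRestrict hM (hj _ ?_)
      · intro x
        simp [Subtype.ext_iff]
      · exact Module.support_subset_of_injective _ (Submodule.subtype_injective _)
    refine vn_sub_mid a W hW ?_
    refine vn_filt a j {p | I < p.asIdeal} ?_ _ ?_
    · intro p hp
      exact ih p.asIdeal hp p.2 (Module.mem_support_mono (p := ⟨I, hI⟩) hp.le hs)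
    · intro p hp
      have hann := Module.annihilator_le_of_mem_support hp
      have hIann : I ≤ Module.annihilator R ((R ⧸ I) ⧸ W) := by
        intro r hr
        rw [Module.mem_annihilator]
        intro m
        obtain ⟨m, rfl⟩ := Submodule.mkQ_surjective _ m
        obtain ⟨m, rfl⟩ := Ideal.Quotient.mk_surjective m
        rw [← map_smul]
        change W.mkQ (Ideal.Quotient.mk _ (r * m)) = 0
        rw [Ideal.Quotient.eq_zero_iff_mem.2 (I.mul_mem_right _ hr), map_zero]
      refine lt_of_le_of_ne (hIann.trans hann) ?_
      intro heq
      apply hφ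
      ext m
      obtain ⟨r, hr⟩ := Ideal.Quotient.mk_surjective (φ m)
      have hrann : r ∈ Module.annihilator R ((R ⧸ I) ⧸ W) := by
        rw [Module.mem_annihilator]
        intro y
        obtain ⟨y, rfl⟩ := Submodule.mkQ_surjective _ y
        obtain ⟨y, rfl⟩ := Ideal.Quotient.mk_surjective y
        rw [← map_smul, Submodule.mkQ_apply, Submodule.Quotient.mk_eq_zero]
        refine ⟨y • m, ?_⟩
        rw [map_smul, ← hr]
        change Ideal.Quotient.mk I (y * r) = Ideal.Quotient.mk I (r * y)
        rw [mul_comm]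
      have : r ∈ I := heq ▸ hann hrann
      rw [← hr, Ideal.Quotient.eq_zero_iff_mem.2 this]; rfl

theorem dnt [IsNoetherianRing R] (M : Type u) [AddCommGroup M] [Module R M] [Module.Finite R M]
    (i0 : ℕ) (hM : ∀ j, i0 ≤ j → VN a j M) (j : ℕ) (hj : i0 ≤ j)
    (N : Type u) [AddCommGroup N] [Module R N] [Module.Finite R N]
    (hN : Module.support R N ⊆ Module.support R M) : VN a j N := by
  obtain ⟨b, hb⟩ := exists_bound a
  have key : ∀ k j : ℕ, i0 ≤ j → b < j + k →
      ∀ (N : Type u) [AddCommGroup N] [Module R N] [Module.Finite R N],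
      Module.support R N ⊆ Module.support R M → VN a j N := by
    intro k
    induction k with
    | zero => intro j _ hj N _ _ _ _; exact hb N j hj
    | succ k ih =>
      intro j hij hj N _ _ _ hN
      refine vn_filt a j (Module.support R M) ?_ N hN
      intro p hp
      exact dnt_step a M j (hM j hij) (fun N _ _ _ h => ih (j+1) (by lia) (by lia) N h)
        p.asIdeal p.2 hp
  exact key (b + 1) j hj (by lia) N hN

end dnt


section nice
open CategoryTheory.Abelian
variable (a : Ideal R)

def Nice (X : Type u) [AddCommGroup X] [Module R X] : Prop :=
  ∀ x ∈ a, ∃ (s n : ℕ) (v : X →ₗ[R] (Fin n → R)) (w : (Fin n → R) →ₗ[R] X),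
    w ∘ₗ v = x ^ s • LinearMap.id

lemma nice_quot (t : ℕ) : Nice a (R ⧸ a ^ t) := by
  intro x hx
  refine ⟨t, 0, 0, 0, ?_⟩
  ext
  change 0 = (Ideal.Quotient.mk (a ^ t)) (x ^ t * 1)
  symm
  rw [Ideal.Quotient.eq_zero_iff_mem, mul_one]
  exact Ideal.pow_mem_pow hx t

lemma nice_syz {X : Type u} [AddCommGroup X] [Module R X] (hX : Nice a X) {n : ℕ}
    (π : (Fin n → R) →ₗ[R] X) (hπ : Function.Surjective π) (x : R) (hx : x ∈ a) :
    ∃ (s : ℕ) (h : (Fin n → R) →ₗ[R] LinearMap.ker π),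
      h ∘ₗ (LinearMap.ker π).subtype = x ^ s • LinearMap.id := by
  obtain ⟨s, m, v, w, hvw⟩ := hX x hx
  obtain ⟨w', hw'⟩ := Module.projective_lifting_property π w hπ
  refine ⟨s, LinearMap.codRestrict _ (x ^ s • LinearMap.id - w' ∘ₗ v ∘ₗ π) ?_, ?_⟩
  · intro c
    rw [LinearMap.mem_ker]
    have h1 := LinearMap.congr_fun hw' (v (π c))
    have h2 := LinearMap.congr_fun hvw (π c)
    simp only [LinearMap.comp_apply, LinearMap.smul_apply, LinearMap.id_apply,
      LinearMap.sub_apply, map_sub, map_smul] at h1 h2 ⊢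
    rw [h1, h2, sub_self]
  · ext c : 1
    apply Subtype.ext
    have : π c.1 = 0 := c.2
    simp [this]

lemma nice_ker {X : Type u} [AddCommGroup X] [Module R X] (hX : Nice a X) {n : ℕ}
    (π : (Fin n → R) →ₗ[R] X) (hπ : Function.Surjective π) : Nice a (LinearMap.ker π) := by
  intro x hx
  obtain ⟨s, h, hh⟩ := nice_syz a hX π hπ x hx
  exact ⟨s, n, _, h, hh⟩

lemma ker_tors [IsNoetherianRing R] {X : Type u} [AddCommGroup X] [Module R X] (hX : Nice a X) {n : ℕ}
    (π : (Fin n → R) →ₗ[R] X) (hπ : Function.Surjective π)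
    (N : Type u) [AddCommGroup N] [Module R N] :
    ATors a (LinearMap.ker (LinearMap.lTensor N (LinearMap.ker π).subtype)) := by
  obtain ⟨T, hT⟩ := (isNoetherianRing_iff_ideal_fg R).1 inferInstance a
  refine ators_of_xt a T hT _ ?_
  intro y hy
  obtain ⟨s, h, hh⟩ := nice_syz a hX π hπ y (hT ▸ Ideal.subset_span hy)
  rintro ⟨z, hz⟩
  refine ⟨s, Subtype.ext ?_⟩
  have h1 : LinearMap.lTensor N h (LinearMap.lTensor N (LinearMap.ker π).subtype z) = y ^ s • z := by
    rw [← LinearMap.comp_apply, ← LinearMap.lTensor_comp, hh, LinearMap.lTensor_smul,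
      LinearMap.lTensor_id]
    rfl
  rw [LinearMap.mem_ker.1 hz, map_zero] at h1
  exact h1.symm

lemma vn_pi (j : ℕ) (N : Type u) [AddCommGroup N] [Module R N] (hN : VN a j N) (n : ℕ) :
    VN a j (Fin n → N) := by
  induction n with
  | zero => exact vn_subsingleton a j
  | succ n ih =>
    refine vn_equiv a (Fin.consLinearEquiv R (fun _ => N)).symm ?_
    exact vn_mid a (LinearMap.inl R N (Fin n → N)) (LinearMap.snd R N (Fin n → N))
      Function.Exact.inl_snd LinearMap.inl_injective LinearMap.snd_surjective hN ih

lemma vn_free (j : ℕ) (N : Type u) [AddCommGroup N] [Module R N] (hN : VN a j N) (n : ℕ) :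
    VN a j (N ⊗[R] (Fin n → R)) :=
  vn_equiv a (TensorProduct.piScalarRight R R N (Fin n)) (vn_pi a j N hN n)

lemma ex1 {X : Type u} [AddCommGroup X] [Module R X] {n : ℕ}
    (π : (Fin n → R) →ₗ[R] X) (hπ : Function.Surjective π)
    (N : Type u) [AddCommGroup N] [Module R N] :
    Function.Exact (LinearMap.range (LinearMap.lTensor N (LinearMap.ker π).subtype)).subtype
      (LinearMap.lTensor N π) := by
  have h := lTensor_exact N (LinearMap.exact_subtype_ker_map π) hπ
  intro z
  rw [h z]
  simp

lemma ex2 {A B : Type u} [AddCommGroup A] [Module R A] [AddCommGroup B] [Module R B]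
    (f : A →ₗ[R] B) : Function.Exact (LinearMap.ker f).subtype f.rangeRestrict := by
  intro x
  simp [Subtype.ext_iff]

lemma L1 [IsNoetherianRing R] (N : Type u) [AddCommGroup N] [Module R N] (g b : ℕ)
    (hb : ∀ (N : Type u) [AddCommGroup N] [Module R N], ∀ i, b < i → VN a i N)
    (hN : ∀ j, g ≤ j → VN a j N) (k : ℕ) : ∀ j, b < j + k → g ≤ j →
    ∀ (X : Type u) [AddCommGroup X] [Module R X] [Module.Finite R X], Nice a X →
      VN a j (N ⊗[R] X) := by
  induction k with
  | zero => intro j hj _ X _ _ _ _; exact hb _ j hj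
  | succ k ih =>
    intro j hj hg X _ _ _ hX
    obtain ⟨n, π, hπ⟩ := Module.Finite.exists_fin' R X
    have h1 := ih (j+1) (by lia) (by lia) (LinearMap.ker π) (nice_ker a hX π hπ)
    refine vn_right a _ _ (ex1 π hπ N) (Submodule.subtype_injective _)
      (LinearMap.lTensor_surjective N hπ) (vn_free a j N (hN j hg) n) ?_
    exact vn_right a _ _ (ex2 (LinearMap.lTensor N (LinearMap.ker π).subtype))
      (Submodule.subtype_injective _) (LinearMap.surjective_rangeRestrict _) h1
      (tors_van a _ _ (ker_tors a hX π hπ N))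

lemma hz_step {A U B C A' U' B' C' K : Type u}
    [AddCommGroup A] [Module R A] [AddCommGroup U] [Module R U]
    [AddCommGroup B] [Module R B] [AddCommGroup C] [Module R C]
    [AddCommGroup A'] [Module R A'] [AddCommGroup U'] [Module R U']
    [AddCommGroup B'] [Module R B'] [AddCommGroup C'] [Module R C']
    [AddCommGroup K] [Module R K]
    (f : U →ₗ[R] B) (g : B →ₗ[R] C) (hfg : Function.Exact f g)
    (hf : Function.Injective f) (hg : Function.Surjective g)
    (f' : U' →ₗ[R] B') (g' : B' →ₗ[R] C') (hfg' : Function.Exact f' g')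
    (hf' : Function.Injective f') (hg' : Function.Surjective g')
    (k : K →ₗ[R] A) (p : A →ₗ[R] U) (hkp : Function.Exact k p)
    (hk : Function.Injective k) (hp : Function.Surjective p)
    (p' : A' →ₗ[R] U') (α : A →ₗ[R] A') (ν : U →ₗ[R] U') (β : B →ₗ[R] B') (γ : C →ₗ[R] C')
    (c1 : ν ∘ₗ p = p' ∘ₗ α) (c2 : β ∘ₗ f = f' ∘ₗ ν) (c3 : γ ∘ₗ g = g' ∘ₗ β)
    (j : ℕ) (hK : VN a (j+2) K) (hα : HZero a (j+1) (ModuleCat.ofHom α)) (hB : VN a j B') :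
    HZero a j (ModuleCat.ofHom γ) := by
  intro t e
  have S := sc_exact f g hfg hf hg
  have S' := sc_exact f' g' hfg' hf' hg'
  have S2 := sc_exact k p hkp hk hp
  let m : sc f g hfg ⟶ sc f' g' hfg' :=
    { τ₁ := ModuleCat.ofHom ν
      τ₂ := ModuleCat.ofHom β
      τ₃ := ModuleCat.ofHom γ
      comm₁₂ := by
        ext x; exact (LinearMap.congr_fun c2 x).symm
      comm₂₃ := by
        ext x; exact (LinearMap.congr_fun c3 x).symm }
  have nat := ShortComplex.ShortExact.extClass_naturality S S' m
  let d : AE _ _ (j+1) := e.comp S.extClass rfl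
  obtain ⟨s, hs, h0⟩ := hK t (d.comp S2.extClass rfl)
  rw [rs_comp] at h0
  obtain ⟨y, hy⟩ := Ext.covariant_sequence_exact₃ _ S2 _ rfl h0
  obtain ⟨r, hr, h1⟩ := hα s y
  have h2 : rs a (hs.trans hr) (d.comp (Ext.mk₀ (ModuleCat.ofHom ν)) (add_zero _)) = 0 := by
    rw [← rs_rs a hs hr, rs_comp, ← hy]
    have : ModuleCat.ofHom p ≫ ModuleCat.ofHom ν = ModuleCat.ofHom α ≫ ModuleCat.ofHom p' := by
      ext x; exact LinearMap.congr_fun c1 x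
    change rs a hr ((y.comp (Ext.mk₀ (ModuleCat.ofHom p)) _).comp _ _) = 0
    rw [Ext.comp_assoc_of_third_deg_zero, Ext.mk₀_comp_mk₀, this, ← Ext.mk₀_comp_mk₀,
      ← Ext.comp_assoc_of_third_deg_zero, rs_comp, h1]
    simp
  have h3 : (rs a (hs.trans hr) (e.comp (Ext.mk₀ (ModuleCat.ofHom γ)) (add_zero j))).comp
      S'.extClass rfl = 0 := by
    rw [← rs_comp, ← h2]
    congr 1
    change _ = (e.comp S.extClass rfl).comp (Ext.mk₀ m.τ₁) (add_zero _)
    rw [Ext.comp_assoc_of_third_deg_zero, nat]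
    exact Ext.comp_assoc _ _ _ _ _ (by lia)
  obtain ⟨z, hz⟩ := Ext.covariant_sequence_exact₃ _ S' _ rfl h3
  obtain ⟨q, hq, h4⟩ := hB r z
  refine ⟨q, (hs.trans hr).trans hq, ?_⟩
  rw [← rs_rs a (hs.trans hr) hq, ← hz, rs_comp, h4]
  simp

lemma L2 [IsNoetherianRing R] (N M : Type u) [AddCommGroup N] [Module R N]
    [AddCommGroup M] [Module R M] (φ : N →ₗ[R] M) (g b : ℕ)
    (hb : ∀ (N : Type u) [AddCommGroup N] [Module R N], ∀ i, b < i → VN a i N)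
    (hN : ∀ j, g ≤ j → VN a j N) (hM : ∀ j, j < g → VN a j M) (k : ℕ) : ∀ j, b < j + k →
    ∀ (X : Type u) [AddCommGroup X] [Module R X] [Module.Finite R X], Nice a X →
      HZero a j (ModuleCat.ofHom (LinearMap.rTensor X φ)) := by
  induction k with
  | zero => intro j hj X _ _ _ _; exact hzero_of_van_left a _ (hb _ j hj)
  | succ k ih =>
    intro j hj X _ _ _ hX
    rcases le_or_gt g j with hg | hg
    · exact hzero_of_van_left a _ (L1 a N g b hb hN (k+1) j hj hg X hX)
    obtain ⟨n, π, hπ⟩ := Module.Finite.exists_fin' R X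
    have h1 := ih (j+1) (by lia) (LinearMap.ker π) (nice_ker a hX π hπ)
    let ι := (LinearMap.ker π).subtype
    have hc : LinearMap.rTensor (Fin n → R) φ ∘ₗ LinearMap.lTensor N ι =
        LinearMap.lTensor M ι ∘ₗ LinearMap.rTensor _ φ := by
      rw [LinearMap.rTensor_comp_lTensor, LinearMap.lTensor_comp_rTensor]
    let ν : LinearMap.range (LinearMap.lTensor N ι) →ₗ[R] LinearMap.range (LinearMap.lTensor M ι) :=
      LinearMap.restrict (LinearMap.rTensor (Fin n → R) φ) (by
        rintro _ ⟨z, rfl⟩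
        exact ⟨_, (LinearMap.congr_fun hc z).symm⟩)
    refine hz_step a _ _ (ex1 π hπ N) (Submodule.subtype_injective _)
      (LinearMap.lTensor_surjective N hπ) _ _ (ex1 π hπ M) (Submodule.subtype_injective _)
      (LinearMap.lTensor_surjective M hπ) _ _ (ex2 (LinearMap.lTensor N ι))
      (Submodule.subtype_injective _) (LinearMap.surjective_rangeRestrict _)
      (LinearMap.lTensor M ι).rangeRestrict _ ν (LinearMap.rTensor (Fin n → R) φ) _ ?_ ?_ ?_ j
      (tors_van a _ _ (ker_tors a hX π hπ N)) h1 (vn_free a j M (hM j hg) n)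
    · refine LinearMap.ext fun z => ?_
      exact Subtype.ext (LinearMap.congr_fun hc z)
    · rfl
    · rw [LinearMap.rTensor_comp_lTensor, LinearMap.lTensor_comp_rTensor]

lemma L3 [IsNoetherianRing R] (N M : Type u) [AddCommGroup N] [Module R N]
    [AddCommGroup M] [Module R M] (φ : N →ₗ[R] M) (g : ℕ)
    (hN : ∀ j, g ≤ j → VN a j N) (hM : ∀ j, j < g → VN a j M) (t : ℕ) (n : N) :
    φ n ∈ (a ^ t • ⊤ : Submodule R M) := by
  obtain ⟨b, hb⟩ := exists_bound a
  have H := L2 a N M φ g b (fun N _ _ i hi => hb N i hi) hN hM (b+1) 0 (by lia) (R ⧸ a ^ t)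
    (nice_quot a t)
  let ψ : (R ⧸ a ^ t) →ₗ[R] N ⊗[R] (R ⧸ a ^ t) := TensorProduct.mk R N (R ⧸ a ^ t) n
  obtain ⟨s, hs, h0⟩ := H t (Ext.mk₀ (ModuleCat.ofHom ψ))
  unfold rs at h0
  rw [Ext.mk₀_comp_mk₀, Ext.mk₀_comp_mk₀, Ext.mk₀_eq_zero_iff] at h0
  have h1 := ConcreteCategory.congr_hom h0 (Submodule.Quotient.mk 1)
  have h2 : φ n ⊗ₜ[R] (Ideal.Quotient.mk (a ^ t) 1) = 0 := h1
  have h3 := congrArg (TensorProduct.tensorQuotEquivQuotSMul M (a ^ t)) h2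
  rw [map_zero] at h3
  have h4 : (TensorProduct.tensorQuotEquivQuotSMul M (a ^ t)) (φ n ⊗ₜ[R] (Ideal.Quotient.mk (a ^ t) 1))
      = Submodule.Quotient.mk (φ n) := by
    rw [TensorProduct.tensorQuotEquivQuotSMul_tmul_mk, one_smul]
  rw [h4, Submodule.Quotient.mk_eq_zero] at h3
  exact h3

lemma L4 [IsNoetherianRing R] (hJ : a ≤ (⊥ : Ideal R).jacobson)
    (N M : Type u) [AddCommGroup N] [Module R N]
    [AddCommGroup M] [Module R M] [Module.Finite R M] (φ : N →ₗ[R] M) (g : ℕ)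
    (hN : ∀ j, g ≤ j → VN a j N) (hM : ∀ j, j < g → VN a j M) : φ = 0 := by
  ext n
  have : φ n ∈ (⨅ t : ℕ, a ^ t • ⊤ : Submodule R M) := by
    rw [Submodule.mem_iInf]
    exact fun t => L3 a N M φ g hN hM t n
  rw [Ideal.iInf_pow_smul_eq_bot_of_le_jacobson a hJ] at this
  exact this
end nice


section fin
variable (a : Ideal R)

lemma nt_iff (i : ℕ) (N : Type u) [AddCommGroup N] [Module R N] :
    Nontrivial (localCoh R a i N) ↔ ¬ VN a i N := by
  rw [← not_subsingleton_iff_nontrivial]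
  exact not_congr (van_iff a i _)

lemma vn_of_rcd_lt [IsNoetherianRing R] (N : Type u) [AddCommGroup N] [Module R N] (j : ℕ)
    (h : rcd R a N < j) : VN a j N := by
  by_contra hn
  obtain ⟨b, hb⟩ := exists_bound a
  have hbdd : BddAbove {i | Nontrivial (localCoh R a i N)} := by
    refine ⟨b, fun i hi => ?_⟩
    by_contra! hbi
    exact (nt_iff a i N).1 hi (hb N i hbi)
  have : j ≤ rcd R a N := le_csSup hbdd ((nt_iff a j N).2 hn)
  lia

lemma rcd_le (N : Type u) [AddCommGroup N] [Module R N] (g : ℕ)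
    (h : ∀ j, g < j → VN a j N) : rcd R a N ≤ g := by
  refine csSup_le' fun i hi => ?_
  by_contra! hh
  exact (nt_iff a i N).1 hi (h i hh)

lemma vn_of_lt_grade [IsNoetherianRing R] (M : Type u) [AddCommGroup M] [Module R M]
    [Module.Finite R M] (hM : a • (⊤ : Submodule R M) ≠ ⊤) (i : ℕ) (hi : i < rgrade R a M) :
    VN a i M := by
  have h1 : ∀ i < rgrade R a M, Subsingleton
      (CategoryTheory.Abelian.Ext.{u} (ModuleCat.of R (R ⧸ a)) (ModuleCat.of R M) i) := by
    intro i hi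
    have := Nat.notMem_of_lt_sInf hi
    rw [Set.mem_setOf_eq, not_nontrivial_iff_subsingleton] at this
    exact (ae_sub_iff i _ _).1 this
  have hlt : a • (⊤ : Submodule R (ModuleCat.of R M)) < ⊤ := lt_of_le_of_ne le_top hM
  obtain ⟨l, hl, hmem, hreg⟩ := ModuleCat.exists_isRegular_of_exists_subsingleton_ext a _
    (ModuleCat.of R M) hlt (ModuleCat.of R (R ⧸ a))
    (by ext p; exact mem_supp_quot a p) h1
  intro t e
  refine ⟨t, le_rfl, ?_⟩
  have := ModuleCat.subsingleton_ext_of_exists_isRegular a (ModuleCat.of R (R ⧸ a ^ t))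
    (by
      intro p hp
      exact Ideal.IsPrime.le_of_pow_le ((mem_supp_quot (a ^ t) p).1 hp))
    (ModuleCat.of R M) hlt l hmem hreg i (hl ▸ hi)
  exact Subsingleton.elim _ _

theorem main [IsNoetherianRing R]
    (hJac : a ≤ (⊥ : Ideal R).jacobson)
    (M : Type u) [AddCommGroup M] [Module R M] [Module.Finite R M] [Nontrivial M] :
    IsRelCM R a M ↔ ∀ p ∈ associatedPrimes R M, rcd R a (R ⧸ p) = rgrade R a M := by
  have hM : a • (⊤ : Submodule R M) ≠ ⊤ := fun h =>
    top_ne_bot (Submodule.eq_bot_of_le_smul_of_le_jacobson_bot a (⊤ : Submodule R M)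
      Module.Finite.fg_top h.ge hJac)
  have hcm : IsRelCM R a M ↔ rgrade R a M = rcd R a M := by
    unfold IsRelCM
    simp [hM]
  rw [hcm]
  have key : ∀ p ∈ associatedPrimes R M, rcd R a (R ⧸ p) ≤ rcd R a M := by
    intro p hp
    obtain ⟨hpr, f, hf⟩ := (isAssociatedPrime_iff_exists_injective_linearMap p M).1 hp
    refine rcd_le a _ _ fun j hj => ?_
    exact dnt a M (rcd R a M + 1) (fun j hj => vn_of_rcd_lt a M j hj) j hj _
      (Module.support_subset_of_injective f hf)
  constructor
  · intro h p hp
    obtain ⟨hpr, f, hf⟩ := (isAssociatedPrime_iff_exists_injective_linearMap p M).1 hp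
    refine le_antisymm ((key p hp).trans h.ge) ?_
    by_contra! hlt
    have h0 := L4 a hJac (R ⧸ p) M f (rgrade R a M)
      (fun j hj => vn_of_rcd_lt a _ j (hlt.trans_le hj)) (vn_of_lt_grade a M hM)
    have : (1 : R ⧸ p) = 0 := hf (by rw [h0]; simp)
    exact one_ne_zero this
  · intro h
    obtain ⟨p, hp⟩ := associatedPrimes.nonempty R M
    refine le_antisymm ((h p hp).ge.trans (key p hp)) ?_
    refine rcd_le a _ _ fun j hj => ?_
    refine vn_filt a j (Module.support R M) ?_ M le_rfl
    intro q hq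
    obtain ⟨p, hp, hpq⟩ := Ideal.exists_minimalPrimes_le (Module.annihilator_le_of_mem_support hq)
    have hp' := Module.associatedPrimes.minimalPrimes_annihilator_subset_associatedPrimes R M hp
    refine dnt a (R ⧸ p) (rgrade R a M + 1)
      (fun j hj => vn_of_rcd_lt a _ j (by rw [h p hp']; exact hj)) j hj _ ?_
    intro r hr
    rw [mem_supp_quot] at hr ⊢
    exact hpq.trans hr
end fin


end RCM

/-- `M` is `a`-relative Cohen-Macaulay iff `cd(a, R/p) = grade(a, M)` for
all associated primes `p` of `M`, when `a` is in the Jacobson radical. -/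
theorem stmt6 [IsNoetherianRing R] (a : Ideal R)
    (hJac : a ≤ (⊥ : Ideal R).jacobson)
    (M : Type u) [AddCommGroup M] [Module R M] [Module.Finite R M] [Nontrivial M] :
    IsRelCM R a M ↔ ∀ p ∈ associatedPrimes R M, rcd R a (R ⧸ p) = rgrade R a M := by
  exact RCM.main a hJac M
end

section
/- Let 𝔞 be a proper ideal of R. If R admits a faithful 𝔞-relative Cohen-Macaulay module M of finite projective dimension, then R is 𝔞-relative Cohen-Macaulay, i.e., grade(𝔞,R) = cd(𝔞,R). -/
open CategoryTheory Opposite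
open scoped TensorProduct

universe u

variable (R : Type u) [CommRing R]

section helpers
open Limits
variable {R}

section bridge
variable {X X' Y : ModuleCat.{u} R} (n : ℕ)

noncomputable abbrev oldF (Y : ModuleCat.{u} R) : ModuleCat.{u} R ⥤ (ModuleCat.{u} R)ᵒᵖ :=
  ((linearYoneda R (ModuleCat.{u} R)).obj Y).rightOp

noncomputable abbrev oldK (P : ProjectiveResolution X) (Y : ModuleCat.{u} R) :=
  ((oldF Y).mapHomologicalComplex _).obj P.complex

noncomputable abbrev oldE (X Y : ModuleCat.{u} R) (n : ℕ) : ModuleCat.{u} R :=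
  ((Ext R (ModuleCat.{u} R) n).obj (op X)).obj Y

noncomputable def oldIso (P : ProjectiveResolution X) (Y : ModuleCat.{u} R) (n : ℕ) :
    ((oldF Y).leftDerived n).obj X ≅ (oldK P Y).homology n := P.isoLeftDerivedObj (oldF Y) n

noncomputable def oldMap (P : ProjectiveResolution X) (Y : ModuleCat.{u} R) (n : ℕ) :
    ((oldK P Y).opcycles n).unop ⟶ oldE X Y n :=
  ((oldIso P Y n).hom ≫ (oldK P Y).homologyι n).unop

noncomputable def oldP (P : ProjectiveResolution X) (Y : ModuleCat.{u} R) (n : ℕ) :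
    ((oldK P Y).opcycles n).unop ⟶ ModuleCat.of R (P.complex.X n ⟶ Y) :=
  ((oldK P Y).pOpcycles n).unop

def cls (P : ProjectiveResolution X) {Y : ModuleCat.{u} R} {n : ℕ} (f : P.complex.X n ⟶ Y)
    (x : oldE X Y n) : Prop := ∃ u, oldP P Y n u = f ∧ oldMap P Y n u = x

lemma cls_exists (P : ProjectiveResolution X) {n : ℕ} (x : oldE X Y n) :
    ∃ f, cls P f x := by
  have : Epi (oldMap P Y n) := by exact unop_epi_of_mono ((oldIso P Y n).hom ≫ (oldK P Y).homologyι n)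
  obtain ⟨u, hu⟩ := (ModuleCat.epi_iff_surjective _).1 this x
  exact ⟨_, u, rfl, hu⟩

lemma cls_cocycle (P : ProjectiveResolution X) {n : ℕ} {x : oldE X Y n} {f} (h : cls P f x) :
    P.complex.d (n+1) n ≫ f = 0 := by
  obtain ⟨u, rfl, -⟩ := h
  have := congrArg (fun k => k.unop.hom u) ((oldK P Y).d_pOpcycles (n+1) n)
  exact this

lemma cls_of_cocycle (P : ProjectiveResolution X) {n : ℕ} (f : P.complex.X n ⟶ Y)
    (h : P.complex.d (n+1) n ≫ f = 0) : ∃ x, cls P f x := by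
  let k : (oldK P Y).X n ⟶ op (ModuleCat.of R R) :=
    (ModuleCat.ofHom (LinearMap.toSpanSingleton R (P.complex.X n ⟶ Y) f) :
      ModuleCat.of R R ⟶ ModuleCat.of R (P.complex.X n ⟶ Y)).op
  have hk : (oldK P Y).d (n+1) n ≫ k = 0 := by
    apply Quiver.Hom.unop_inj
    ext
    change P.complex.d (n+1) n ≫ ((1:R) • f) = 0
    simp [h]
  let v := (oldK P Y).descOpcycles k (n+1) (by simp) hk
  have hv := (oldK P Y).p_descOpcycles k (n+1) (by simp) hk
  refine ⟨_, v.unop.hom (1:R), ?_, rfl⟩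
  have := congrArg (fun k => k.unop.hom (1:R)) hv
  refine this.trans ?_
  change (1:R) • f = f
  simp

lemma oldP_inj (P : ProjectiveResolution X) : Function.Injective (oldP P Y n) := by
  rw [← ModuleCat.mono_iff_injective]; exact unop_mono_of_epi ((oldK P Y).pOpcycles n)

lemma cls_zero_iff (P : ProjectiveResolution X) {n : ℕ} {x : oldE X Y n} {f} (h : cls P f x) :
    x = 0 ↔ ∃ g, P.complex.d n ((ComplexShape.down ℕ).next n) ≫ g = f := by
  obtain ⟨u, rfl, rfl⟩ := h
  let j := (ComplexShape.down ℕ).next n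
  let q : ModuleCat.of R (P.complex.X j ⟶ Y) ⟶ ((oldK P Y).opcycles n).unop :=
    ((oldK P Y).fromOpcycles n j).unop
  have hq : ∀ g, oldP P Y n (q g) = P.complex.d n j ≫ g := by
    intro g
    exact congrArg (fun k => k.unop.hom g) ((oldK P Y).p_fromOpcycles n j)
  have hex : ∀ u, oldMap P Y n u = 0 ↔ ∃ g, q g = u := by
    intro u
    have h1 := (oldK P Y).homologyι_comp_fromOpcycles n j
    have e1 : (ShortComplex.mk _ _ h1).Exact :=
      ShortComplex.exact_of_f_is_kernel _ ((oldK P Y).homologyIsKernel n j rfl)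
    have e2 := e1.unop
    rw [ShortComplex.moduleCat_exact_iff] at e2
    constructor
    · intro hu
      refine e2 u ?_
      replace hu : (oldIso P Y n).hom.unop.hom (((oldK P Y).homologyι n).unop.hom u) = 0 := hu
      have : Mono (oldIso P Y n).hom.unop := inferInstance
      exact (ModuleCat.mono_iff_injective _).1 this (hu.trans (map_zero _).symm)
    · rintro ⟨g, rfl⟩
      have := congrArg (fun k => k.unop.hom g) h1
      exact (congrArg (oldIso P Y n).hom.unop.hom this).trans (map_zero _)
  rw [hex]
  constructor
  · rintro ⟨g, rfl⟩; exact ⟨g, (hq g).symm⟩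
  · rintro ⟨g, hg⟩; exact ⟨g, oldP_inj n P ((hq g).trans hg)⟩

lemma cls_nat (P : ProjectiveResolution X) (P' : ProjectiveResolution X') {g : X' ⟶ X}
    (φ : ProjectiveResolution.Hom P' P g) {n : ℕ} {x : oldE X Y n} {f} (h : cls P f x) :
    cls P' (φ.hom.f n ≫ f) (((Ext R (ModuleCat.{u} R) n).map g.op).app Y x) := by
  obtain ⟨u, rfl, rfl⟩ := h
  let Φ : oldK P' Y ⟶ oldK P Y := ((oldF Y).mapHomologicalComplex _).map φ.hom
  refine ⟨(HomologicalComplex.opcyclesMap Φ n).unop.hom u, ?_, ?_⟩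
  · have := congrArg (fun k => k.unop.hom u) (HomologicalComplex.p_opcyclesMap Φ n)
    exact this
  · have h1 : ((oldF Y).leftDerived n).map g ≫ (oldIso P Y n).hom =
        (oldIso P' Y n).hom ≫ HomologicalComplex.homologyMap Φ n :=
      P'.isoLeftDerivedObj_hom_naturality g P φ.hom
        (by simpa using φ.hom_f_zero_comp_π_f_zero) (oldF Y) n
    have h2 := HomologicalComplex.homologyι_naturality Φ n
    have h3 : ((oldF Y).leftDerived n).map g ≫ (oldIso P Y n).hom ≫ (oldK P Y).homologyι n
      = ((oldIso P' Y n).hom ≫ (oldK P' Y).homologyι n) ≫ HomologicalComplex.opcyclesMap Φ n := by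
      rw [← Category.assoc, h1, Category.assoc, Category.assoc, h2]
    exact (congrArg (fun k => k.unop.hom u) h3).symm

lemma extMk_zero_iff (P : ProjectiveResolution X) (n : ℕ) (f : P.complex.X n ⟶ Y)
    (hf : P.complex.d (n+1) n ≫ f = 0) :
    P.extMk f (n+1) rfl hf = 0 ↔
      ∃ g, P.complex.d n ((ComplexShape.down ℕ).next n) ≫ g = f := by
  rcases n with _ | p
  · constructor
    · intro h
      refine ⟨0, ?_⟩
      simp only [← P.extEquivCohomologyClass.apply_eq_iff_eq,
        ProjectiveResolution.extEquivCohomologyClass_extMk, ProjectiveResolution.extEquivCohomologyClass_zero,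
        CochainComplex.HomComplex.CohomologyClass.mk_eq_zero_iff] at h
      rw [CochainComplex.HomComplex.Cocycle.toSingleMk_mem_coboundaries_iff _ _ _ _ _ 1 (by lia)] at h
      obtain ⟨g, hg⟩ := h
      have hz : IsZero (P.cochainComplex.X 1) :=
        HomologicalComplex.isZero_extend_X _ _ _ (by intro i; simp; lia)
      rw [hz.eq_of_src g 0, comp_zero] at hg
      rw [← cancel_epi (P.cochainComplexXIso (-(0:ℕ)) 0 rfl).hom, ← hg]; simp
    · rintro ⟨g, hg⟩
      have : P.complex.d 0 ((ComplexShape.down ℕ).next 0) = 0 := by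
        apply HomologicalComplex.shape; simp
      rw [this, zero_comp] at hg
      subst hg; simp
  · have : (ComplexShape.down ℕ).next (p+1) = p := ComplexShape.next_eq' _ (by simp)
    rw [this]
    exact P.extMk_eq_zero_iff f (p+2) rfl hf p rfl

def Match {X Y : ModuleCat.{u} R} {n : ℕ} (x : oldE X Y n) (e : Abelian.Ext X Y n) : Prop :=
  ∃ (f : _) (hf : _), cls (projectiveResolution X) f x ∧
    (projectiveResolution X).extMk f (n+1) rfl hf = e

lemma match_l {n : ℕ} (x : oldE X Y n) : ∃ e, Match x e := by
  obtain ⟨f, h⟩ := cls_exists (projectiveResolution X) x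
  exact ⟨_, f, cls_cocycle _ h, h, rfl⟩

lemma match_r {n : ℕ} (e : Abelian.Ext X Y n) : ∃ x : oldE X Y n, Match x e := by
  obtain ⟨f, hf, h⟩ := (projectiveResolution X).extMk_surjective e (n+1) rfl
  obtain ⟨x, hx⟩ := cls_of_cocycle _ f hf
  exact ⟨x, f, hf, hx, h⟩

lemma match_zero {n : ℕ} {x : oldE X Y n} {e : Abelian.Ext X Y n} (h : Match x e) :
    x = 0 ↔ e = 0 := by
  obtain ⟨f, hf, h1, rfl⟩ := h
  rw [cls_zero_iff _ h1, extMk_zero_iff]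

lemma match_nat {n : ℕ} {x : oldE X Y n} {e : Abelian.Ext X Y n} (h : Match x e) (g : X' ⟶ X) :
    Match (((Ext R (ModuleCat.{u} R) n).map g.op).app Y x)
      ((Abelian.Ext.mk₀ g).comp e (zero_add n)) := by
  obtain ⟨f, hf, h1, rfl⟩ := h
  let φ : ProjectiveResolution.Hom (projectiveResolution X') (projectiveResolution X) g :=
    ⟨ProjectiveResolution.lift g _ _, by
      have := ProjectiveResolution.lift_commutes_zero g (projectiveResolution X') (projectiveResolution X)
      simpa using this⟩
  refine ⟨_, _, cls_nat _ (projectiveResolution X') φ h1, (ProjectiveResolution.mk₀_comp_extMk f (n+1) rfl hf φ).symm⟩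

lemma nontrivial_old_iff {n : ℕ} : Nontrivial (oldE X Y n) ↔ ∃ e : Abelian.Ext X Y n, e ≠ 0 := by
  rw [nontrivial_iff_exists_ne (0 : oldE X Y n)]
  constructor
  · rintro ⟨x, hx⟩
    obtain ⟨e, he⟩ := match_l x
    exact ⟨e, fun h => hx ((match_zero he).2 h)⟩
  · rintro ⟨x, hx⟩
    obtain ⟨e, he⟩ := match_r x
    exact ⟨e, fun h => hx ((match_zero he).1 h)⟩

end bridge

section api
variable (R) in
noncomputable abbrev EE (A B : Type u) [AddCommGroup A] [Module R A] [AddCommGroup B] [Module R B]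
    (n : ℕ) := Abelian.Ext (ModuleCat.of R A) (ModuleCat.of R B) n

variable {A A' A'' B B' B'' C X Y : Type u} [AddCommGroup A] [Module R A] [AddCommGroup B]
  [Module R B] [AddCommGroup C] [Module R C] [AddCommGroup A'] [Module R A']
  [AddCommGroup A''] [Module R A''] [AddCommGroup B'] [Module R B']
  [AddCommGroup B''] [Module R B'']
  [AddCommGroup X] [Module R X] [AddCommGroup Y] [Module R Y] {n : ℕ}

noncomputable def pre (f : A' →ₗ[R] A) : EE R A B n →ₗ[R] EE R A' B n :=
  (Abelian.Ext.mk₀ (ModuleCat.ofHom f)).precompOfLinear R _ (zero_add n)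

noncomputable def post (g : B →ₗ[R] B') : EE R A B n →ₗ[R] EE R A B' n :=
  (Abelian.Ext.mk₀ (ModuleCat.ofHom g)).postcompOfLinear R _ (add_zero n)

lemma pre_apply (f : A' →ₗ[R] A) (e : EE R A B n) :
  pre f e = (Abelian.Ext.mk₀ (ModuleCat.ofHom f)).comp e (zero_add n) := rfl

lemma post_apply (f : B →ₗ[R] B') (e : EE R A B n) :
  post f e = e.comp (Abelian.Ext.mk₀ (ModuleCat.ofHom f)) (add_zero n) := rfl

lemma pre_pre (f : A'' →ₗ[R] A') (g : A' →ₗ[R] A) (e : EE R A B n) :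
    pre f (pre g e) = pre (g ∘ₗ f) e := by
  simp [pre_apply, ModuleCat.ofHom_comp]

lemma post_post (f : B →ₗ[R] B') (g : B' →ₗ[R] B'') (e : EE R A B n) :
    post g (post f e) = post (g ∘ₗ f) e := by
  simp [post_apply, ModuleCat.ofHom_comp]

lemma pre_post (f : A' →ₗ[R] A) (g : B →ₗ[R] B') (e : EE R A B n) :
    pre f (post g e) = post g (pre f e) := by
  simp only [pre_apply, post_apply]
  rw [Abelian.Ext.comp_assoc _ _ _ _ _ (by simp)]

lemma pre_id (e : EE R A B n) : pre LinearMap.id e = e := by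
  simp [pre_apply]

lemma post_id (e : EE R A B n) : post LinearMap.id e = e := by
  simp [post_apply]

lemma pre_smul (s : R) (f : A' →ₗ[R] A) (e : EE R A B n) : pre (s • f) e = s • pre f e := by
  have : ModuleCat.ofHom (s • f) = s • ModuleCat.ofHom f := rfl
  simp [pre_apply, this, Abelian.Ext.mk₀_smul]

lemma post_smul (s : R) (f : B →ₗ[R] B') (e : EE R A B n) : post (s • f) e = s • post f e := by
  have : ModuleCat.ofHom (s • f) = s • ModuleCat.ofHom f := rfl
  simp [post_apply, this, Abelian.Ext.mk₀_smul]

lemma pre_zero (e : EE R A B n) : pre (0 : A' →ₗ[R] A) e = 0 := by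
  simpa using pre_smul (0:R) (0 : A' →ₗ[R] A) e

lemma post_zero (e : EE R A B n) : post (0 : B →ₗ[R] B') e = 0 := by
  simpa using post_smul (0:R) (0 : B →ₗ[R] B') e

lemma post_add (f g : B →ₗ[R] B') (e : EE R A B n) : post (f + g) e = post f e + post g e := by
  have : ModuleCat.ofHom (f + g) = ModuleCat.ofHom f + ModuleCat.ofHom g := rfl
  simp [post_apply, this, Abelian.Ext.mk₀_add]

lemma post_sum {ι : Type*} (S : Finset ι) (f : ι → (B →ₗ[R] B')) (e : EE R A B n) :
    post (∑ i ∈ S, f i) e = ∑ i ∈ S, post (f i) e := by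
  classical
  induction S using Finset.induction_on with
  | empty => simp [post_zero]
  | insert i S hi ih => rw [Finset.sum_insert hi, Finset.sum_insert hi, post_add, ih]

lemma smul_of_ann_left (s : R) (h : ∀ a : A, s • a = 0) (e : EE R A B n) : s • e = 0 := by
  have : s • (LinearMap.id : A →ₗ[R] A) = 0 := by ext a; simpa using h a
  rw [← pre_id (s • e), map_smul, ← pre_smul, this, pre_zero]

lemma smul_of_ann_right (s : R) (h : ∀ a : B, s • a = 0) (e : EE R A B n) : s • e = 0 := by
  have : s • (LinearMap.id : B →ₗ[R] B) = 0 := by ext a; simpa using h a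
  rw [← post_id (s • e), map_smul, ← post_smul, this, post_zero]

lemma post_equiv_inj (f : B ≃ₗ[R] B') (e : EE R A B n) (h : post f.toLinearMap e = 0) : e = 0 := by
  have := post_post f.toLinearMap f.symm.toLinearMap e
  rw [h, map_zero] at this
  simpa [post_id] using this.symm

lemma pre_equiv_inj (f : A' ≃ₗ[R] A) (e : EE R A B n) (h : pre f.toLinearMap e = 0) : e = 0 := by
  have := pre_pre f.symm.toLinearMap f.toLinearMap e
  rw [h, map_zero] at this
  simpa [pre_id] using this.symm

lemma EE_projective [Module.Projective R A] (e : EE R A B (n+1)) : e = 0 := by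
  have : Projective (ModuleCat.of R A) := (IsProjective.iff_projective A).1 inferInstance
  exact Abelian.Ext.eq_zero_of_projective e

structure SES (f : A →ₗ[R] B) (g : B →ₗ[R] C) : Prop where
  inj : Function.Injective f
  ex : Function.Exact f g
  surj : Function.Surjective g

variable {f : A →ₗ[R] B} {g : B →ₗ[R] C}

namespace SES
noncomputable abbrev sc (h : SES f g) : ShortComplex (ModuleCat.{u} R) :=
  ShortComplex.mk (ModuleCat.ofHom f) (ModuleCat.ofHom g)
    (by ext x; exact (h.ex (f x)).2 ⟨x, rfl⟩)

lemma se (h : SES f g) : h.sc.ShortExact :=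
  have h1 : h.sc.Exact := by
    rw [ShortComplex.moduleCat_exact_iff]
    intro x hx
    exact (h.ex x).1 hx
  have : Mono h.sc.f := (ModuleCat.mono_iff_injective _).2 h.inj
  have : Epi h.sc.g := (ModuleCat.epi_iff_surjective _).2 h.surj
  ⟨h1⟩

noncomputable def dcov (h : SES f g) : EE R X C n →ₗ[R] EE R X A (n+1) :=
  h.se.extClass.postcompOfLinear R _ rfl

noncomputable def dcon (h : SES f g) : EE R A Y n →ₗ[R] EE R C Y (n+1) :=
  h.se.extClass.precompOfLinear R _ (add_comm _ _)

lemma dcov_pre (h : SES f g) (k : A' →ₗ[R] X) (e : EE R X C n) :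
    pre k (h.dcov e) = h.dcov (pre k e) := by
  change (Abelian.Ext.mk₀ _).comp (e.comp h.se.extClass rfl) (zero_add _) =
    ((Abelian.Ext.mk₀ _).comp e (zero_add _)).comp h.se.extClass rfl
  rw [Abelian.Ext.comp_assoc _ _ _ _ _ (by simp)]

lemma cov2 (h : SES f g) (e : EE R X B n) (he : post g e = 0) : ∃ e', post f e' = e :=
  Abelian.Ext.covariant_sequence_exact₂ _ h.se e he

lemma cov3 (h : SES f g) (e : EE R X C n) (he : h.dcov e = 0) : ∃ e', post g e' = e :=
  Abelian.Ext.covariant_sequence_exact₃ _ h.se e rfl he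

lemma cov1 (h : SES f g) (e : EE R X A (n+1)) (he : post f e = 0) :
    ∃ e' : EE R X C n, h.dcov e' = e :=
  Abelian.Ext.covariant_sequence_exact₁ _ h.se e he rfl

lemma cov0 (h : SES f g) (e : EE R X A 0) (he : post f e = 0) : e = 0 := by
  have : Mono (ModuleCat.ofHom f) := (ModuleCat.mono_iff_injective _).2 h.inj
  exact Abelian.Ext.postcomp_mk₀_injective_of_mono (ModuleCat.of R X) (ModuleCat.ofHom f)
    (he.trans (map_zero (post f)).symm)

lemma con2 (h : SES f g) (e : EE R B Y n) (he : pre f e = 0) : ∃ e', pre g e' = e :=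
  Abelian.Ext.contravariant_sequence_exact₂ h.se _ e he

lemma con1 (h : SES f g) (e : EE R A Y n) (he : h.dcon e = 0) : ∃ e', pre f e' = e :=
  Abelian.Ext.contravariant_sequence_exact₁ h.se _ e (add_comm _ _) he

lemma con3 (h : SES f g) (e : EE R C Y (n+1)) (he : pre g e = 0) :
    ∃ e' : EE R A Y n, h.dcon e' = e :=
  Abelian.Ext.contravariant_sequence_exact₃ h.se _ e he (add_comm _ _)

lemma con0 (h : SES f g) (e : EE R C Y 0) (he : pre g e = 0) : e = 0 := by
  have : Epi (ModuleCat.ofHom g) := (ModuleCat.epi_iff_surjective _).2 h.surj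
  exact Abelian.Ext.precomp_mk₀_injective_of_epi (ModuleCat.of R Y) (ModuleCat.ofHom g)
    (he.trans (map_zero (pre g)).symm)

lemma dcov_post (h : SES f g) (e : EE R X C n) : post f (h.dcov e) = 0 := by
  change (e.comp h.se.extClass rfl).comp (Abelian.Ext.mk₀ _) (add_zero _) = 0
  rw [Abelian.Ext.comp_assoc _ _ _ _ (add_zero 1) (by simp)]
  have := h.se.extClass_comp
  erw [this]
  simp

lemma dcon_pre (h : SES f g) (e : EE R A Y n) : pre g (h.dcon e) = 0 := by
  change (Abelian.Ext.mk₀ _).comp (h.se.extClass.comp e (add_comm _ _)) (zero_add _) = 0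
  exact h.se.comp_extClass_assoc e (add_comm _ _)

lemma post_dcov (h : SES f g) (e : EE R X B n) : h.dcov (post g e) = 0 := by
  change (e.comp (Abelian.Ext.mk₀ _) (add_zero _)).comp h.se.extClass rfl = 0
  rw [Abelian.Ext.comp_assoc _ _ _ _ (zero_add 1) (by simp)]
  have := h.se.comp_extClass
  erw [this]
  simp

/-- naturality of the contravariant connecting map. -/
lemma dcon_nat (h : SES f g) {f' : A' →ₗ[R] B'} {g' : B' →ₗ[R] B''} (h' : SES f' g')
    (α : A' →ₗ[R] A) (β : B' →ₗ[R] B) (γ : B'' →ₗ[R] C) (h1 : β ∘ₗ f' = f ∘ₗ α)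
    (h2 : γ ∘ₗ g' = g ∘ₗ β) (e : EE R A Y n) : pre γ (h.dcon e) = h'.dcon (pre α e) := by
  let φ : h'.sc ⟶ h.sc :=
    { τ₁ := ModuleCat.ofHom α, τ₂ := ModuleCat.ofHom β, τ₃ := ModuleCat.ofHom γ
      comm₁₂ := by rw [← ModuleCat.ofHom_comp, ← ModuleCat.ofHom_comp, h1]
      comm₂₃ := by rw [← ModuleCat.ofHom_comp, ← ModuleCat.ofHom_comp, h2] }
  have := ShortComplex.ShortExact.extClass_naturality h'.se h.se φ
  change (Abelian.Ext.mk₀ _).comp (h.se.extClass.comp e (add_comm _ _)) (zero_add _) =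
    h'.se.extClass.comp ((Abelian.Ext.mk₀ _).comp e (zero_add _)) (add_comm _ _)
  rw [← Abelian.Ext.comp_assoc _ _ _ (zero_add 1) _ (by omega),
    ← Abelian.Ext.comp_assoc _ _ _ (add_zero 1) _ (by omega)]
  exact congrArg (fun z => Abelian.Ext.comp z e (by omega)) this.symm

end SES

lemma SES.of_sub (N : Submodule R A) : SES N.subtype N.mkQ :=
  ⟨N.injective_subtype, LinearMap.exact_subtype_mkQ N, N.mkQ_surjective⟩

lemma SES.of_surj (g : B →ₗ[R] C) (hg : Function.Surjective g) : SES (LinearMap.ker g).subtype g :=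
  ⟨Submodule.injective_subtype _, LinearMap.exact_subtype_ker_map g, hg⟩

end api

section vv

def qm {J' J : Ideal R} (h : J' ≤ J) : (R ⧸ J') →ₗ[R] (R ⧸ J) :=
  Submodule.mapQ J' J LinearMap.id h

lemma qm_mk {J' J : Ideal R} (h : J' ≤ J) (x : R) :
    qm h (Ideal.Quotient.mk J' x) = Ideal.Quotient.mk J x := rfl

lemma qm_qm {J'' J' J : Ideal R} (h : J' ≤ J) (h' : J'' ≤ J') :
    qm h ∘ₗ qm h' = qm (h'.trans h) := by
  ext; rfl

lemma qm_surj {J' J : Ideal R} (h : J' ≤ J) : Function.Surjective (qm h) := by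
  intro y
  obtain ⟨y, rfl⟩ := Ideal.Quotient.mk_surjective y
  exact ⟨Ideal.Quotient.mk _ y, rfl⟩

def V (a : Ideal R) (i : ℕ) (N : Type u) [AddCommGroup N] [Module R N] : Prop :=
  ∀ J : Ideal R, a ≤ J.radical → ∀ e : EE R (R ⧸ J) N i,
    ∃ (J' : Ideal R) (h : J' ≤ J), a ≤ J'.radical ∧ pre (qm h) e = 0

variable {A B C N : Type u} [AddCommGroup A] [Module R A] [AddCommGroup B]
  [Module R B] [AddCommGroup C] [Module R C] [AddCommGroup N] [Module R N] {a b : Ideal R} {i : ℕ}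
  {f : A →ₗ[R] B} {g : B →ₗ[R] C}

lemma V.mid (h : SES f g) (hA : V a i A) (hC : V a i C) : V a i B := by
  intro J hJ e
  obtain ⟨J1, h1, hJ1, e1⟩ := hC J hJ (post g e)
  rw [pre_post] at e1
  obtain ⟨e', he'⟩ := h.cov2 _ e1
  obtain ⟨J2, h2, hJ2, e2⟩ := hA J1 hJ1 e'
  refine ⟨J2, h2.trans h1, hJ2, ?_⟩
  rw [← qm_qm h1 h2, ← pre_pre, ← he', pre_post, e2, map_zero]

lemma V.right (h : SES f g) (hA : V a (i+1) A) (hB : V a i B) : V a i C := by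
  intro J hJ e
  obtain ⟨J1, h1, hJ1, e1⟩ := hA J hJ (h.dcov e)
  rw [h.dcov_pre] at e1
  obtain ⟨e', he'⟩ := h.cov3 _ e1
  obtain ⟨J2, h2, hJ2, e2⟩ := hB J1 hJ1 e'
  refine ⟨J2, h2.trans h1, hJ2, ?_⟩
  rw [← qm_qm h1 h2, ← pre_pre, ← he', pre_post, e2, map_zero]

lemma V.equiv (f : A ≃ₗ[R] B) (hA : V a i A) : V a i B := by
  intro J hJ e
  obtain ⟨J1, h1, hJ1, e1⟩ := hA J hJ (post f.symm.toLinearMap e)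
  rw [pre_post] at e1
  exact ⟨J1, h1, hJ1, post_equiv_inj _ _ e1⟩

lemma V.reg {x : R} (hx : x ∈ a) (hreg : Function.Injective (x • (LinearMap.id : N →ₗ[R] N)))
    (hV : V a i (N ⧸ LinearMap.range (x • (LinearMap.id : N →ₗ[R] N)))) : V a (i+1) N := by
  have h : SES (x • (LinearMap.id : N →ₗ[R] N)) (LinearMap.range (x • (LinearMap.id : N →ₗ[R] N))).mkQ :=
    ⟨hreg, LinearMap.exact_map_mkQ_range _, Submodule.mkQ_surjective _⟩
  have key : ∀ t : ℕ, ∀ J : Ideal R, a ≤ J.radical → ∀ e : EE R (R ⧸ J) N (i+1), x ^ t • e = 0 →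
    ∃ (J' : Ideal R) (h : J' ≤ J), a ≤ J'.radical ∧ pre (qm h) e = 0 := by
    intro t
    induction t with
    | zero => 
      intro J hJ e he
      refine ⟨J, le_rfl, hJ, ?_⟩
      rw [pow_zero, one_smul] at he
      rw [he, map_zero]
    | succ t ih =>
      intro J hJ e he
      have h0 : post (x • (LinearMap.id : N →ₗ[R] N)) (x ^ t • e) = 0 := by
        rw [post_smul, post_id, smul_smul, ← pow_succ', he]
      obtain ⟨c, hc⟩ := h.cov1 _ h0
      obtain ⟨J1, h1, hJ1, e1⟩ := hV J hJ c
      have : x ^ t • pre (qm h1) e = 0 := by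
        rw [← map_smul, ← hc, h.dcov_pre, e1, map_zero]
      obtain ⟨J2, h2, hJ2, e2⟩ := ih J1 hJ1 _ this
      refine ⟨J2, h2.trans h1, hJ2, ?_⟩
      rw [← qm_qm h1 h2, ← pre_pre, e2]
  intro J hJ e
  obtain ⟨t, ht⟩ := hJ hx
  refine key t J hJ e (smul_of_ann_left _ ?_ e)
  intro y
  obtain ⟨y, rfl⟩ := Ideal.Quotient.mk_surjective y
  change Ideal.Quotient.mk J (x ^ t * y) = 0
  exact Ideal.Quotient.eq_zero_iff_mem.2 (J.mul_mem_right _ ht)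

lemma ses_pow (B' : Ideal R) (y : R) :
    SES (LinearMap.range (y • (LinearMap.id : (R ⧸ B') →ₗ[R] (R ⧸ B')))).subtype
      (qm (le_sup_left : B' ≤ B' ⊔ Ideal.span {y})) := by
  refine ⟨Submodule.injective_subtype _, ?_, qm_surj _⟩
  intro z
  obtain ⟨z, rfl⟩ := Ideal.Quotient.mk_surjective z
  rw [qm_mk, Ideal.Quotient.eq_zero_iff_mem]
  constructor
  · intro hz
    obtain ⟨p, hp, q, hq, rfl⟩ := Submodule.mem_sup.1 hz
    obtain ⟨r, rfl⟩ := Ideal.mem_span_singleton'.1 hq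
    refine ⟨⟨_, Ideal.Quotient.mk _ r, rfl⟩, ?_⟩
    simp only [Submodule.subtype_apply, LinearMap.smul_apply, LinearMap.id_apply, map_add,
      Ideal.Quotient.eq_zero_iff_mem.2 hp, zero_add]
    rw [mul_comm]; rfl
  · rintro ⟨⟨_, w, rfl⟩, hw⟩
    obtain ⟨w, rfl⟩ := Ideal.Quotient.mk_surjective w
    have : Ideal.Quotient.mk B' (y * w) = Ideal.Quotient.mk B' z := hw
    rw [Ideal.Quotient.eq] at this
    have h2 : y * w ∈ B' ⊔ Ideal.span {y} := 
      Ideal.mul_mem_right _ _ (Submodule.mem_sup_right (Ideal.mem_span_singleton_self y))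
    have := Ideal.sub_mem _ h2 (Submodule.mem_sup_left (T := Ideal.span {y}) this)
    simpa using this

lemma pow_mem_of_le {J : Ideal R} {x : R} {t m : ℕ} (h : t ≤ m) (hx : x ^ t ∈ J) : x ^ m ∈ J := by
  rw [← Nat.sub_add_cancel h, pow_add]; exact J.mul_mem_left _ hx

lemma V.nil [IsNoetherianRing R] {x : R} {k : ℕ} (hx : ∀ y : N, x ^ k • y = 0)
    (hV : V b i N) : V (b ⊔ Ideal.span {x}) i N := by
  intro J hJ e
  obtain ⟨B', hB, hbB, eB⟩ := hV J (le_sup_left.trans hJ) e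
  obtain ⟨t, ht⟩ : x ∈ J.radical :=
    hJ (Submodule.mem_sup_right (Ideal.mem_span_singleton_self x))
  let φ : (R ⧸ B') →ₗ[R] (R ⧸ B') := x • LinearMap.id
  have hφ : ∀ m, φ ^ m = x ^ m • LinearMap.id := by
    intro m
    simp only [φ, smul_pow]
    congr 1
    exact one_pow m
  obtain ⟨n, hn⟩ := Filter.eventually_atTop.1 (Module.End.eventually_disjoint_ker_pow_range_pow φ)
  obtain ⟨m, hm1, hm2, hm3⟩ : ∃ m, t ≤ m ∧ n ≤ m ∧ k ≤ m := ⟨t + n + k, by omega, by omega, by omega⟩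
  have hdis := hn m hm2
  rw [hφ] at hdis
  have le1 : B' ⊔ Ideal.span {x ^ m} ≤ J := sup_le hB
    ((Ideal.span_singleton_le_iff_mem _).2 (pow_mem_of_le hm1 ht))
  have le2 : B' ⊔ Ideal.span {x ^ (m+k)} ≤ B' ⊔ Ideal.span {x ^ m} := sup_le le_sup_left
    ((Ideal.span_singleton_le_iff_mem _).2 (pow_mem_of_le (Nat.le_add_right m k)
      (Submodule.mem_sup_right (Ideal.mem_span_singleton_self _))))
  have hrad : ∀ m, b ⊔ Ideal.span {x} ≤ (B' ⊔ Ideal.span {x ^ m}).radical := by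
    intro m
    refine sup_le (hbB.trans (Ideal.radical_mono le_sup_left)) ?_
    rw [Ideal.span_singleton_le_iff_mem]
    exact ⟨m, Submodule.mem_sup_right (Ideal.mem_span_singleton_self _)⟩
  have s1 := ses_pow B' (x ^ m)
  have s2 := ses_pow B' (x ^ (m+k))
  have e1 : pre (qm (le_sup_left : B' ≤ B' ⊔ Ideal.span {x ^ m})) (pre (qm le1) e) = 0 := by
    rw [pre_pre, qm_qm, eB]
  cases i with
  | zero => exact ⟨_, le1, hrad _, s1.con0 _ e1⟩
  | succ i =>
    obtain ⟨f, hf⟩ := s1.con3 _ e1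
    refine ⟨_, le2.trans le1, hrad _, ?_⟩
    have hle : LinearMap.range (x ^ (m+k) • (LinearMap.id : (R ⧸ B') →ₗ[R] (R ⧸ B'))) ≤
        LinearMap.range (x ^ m • (LinearMap.id : (R ⧸ B') →ₗ[R] (R ⧸ B'))) := by
      rintro _ ⟨z, rfl⟩
      exact ⟨x ^ k • z, by simp [smul_smul, pow_add, mul_comm]⟩
    have hz : pre (Submodule.inclusion hle) f = 0 := by
      let ψ : LinearMap.range (x ^ m • (LinearMap.id : (R ⧸ B') →ₗ[R] (R ⧸ B'))) →ₗ[R]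
         LinearMap.range (x ^ (m+k) • (LinearMap.id : (R ⧸ B') →ₗ[R] (R ⧸ B'))) :=
        (x ^ k • (Submodule.subtype _)).codRestrict _ (by
          rintro ⟨_, z, rfl⟩
          exact ⟨z, by simp [smul_smul, pow_add, mul_comm]⟩)
      have hψ : Function.Bijective ψ := by
        constructor
        · rw [injective_iff_map_eq_zero]
          rintro ⟨y, hy⟩ h0
          have h0' : x ^ k • y = 0 := congrArg Subtype.val h0
          have : y = 0 := by
            refine Submodule.disjoint_def.1 hdis y ?_ hy
            rw [LinearMap.mem_ker, LinearMap.smul_apply, LinearMap.id_apply,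
              ← Nat.sub_add_cancel hm3, pow_add, mul_smul, h0', smul_zero]
          exact Subtype.ext this
        · rintro ⟨_, z, rfl⟩
          refine ⟨⟨_, z, rfl⟩, Subtype.ext ?_⟩
          simp [ψ, smul_smul, pow_add, mul_comm]
      refine pre_equiv_inj (LinearEquiv.ofBijective ψ hψ) _ ?_
      rw [pre_pre]
      have : Submodule.inclusion hle ∘ₗ (LinearEquiv.ofBijective ψ hψ).toLinearMap
          = x ^ k • LinearMap.id := by
        ext y
        rfl
      rw [this, pre_smul, pre_id]
      exact smul_of_ann_right _ hx f
    have := s1.dcon_nat s2 (Submodule.inclusion hle) LinearMap.id (qm le2) rfl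
      (by rw [qm_qm]; rfl) f
    rw [hz, map_zero, hf, pre_pre, qm_qm] at this
    exact this

lemma V.step [IsNoetherianRing R] (x : R) (r : ℕ)
    (hV : ∀ i, r ≤ i → ∀ (N : Type u) [AddCommGroup N] [Module R N] [Module.Finite R N], V b i N)
    (i : ℕ) (hi : r + 1 ≤ i) (N : Type u) [AddCommGroup N] [Module R N] [Module.Finite R N] :
    V (b ⊔ Ideal.span {x}) i N := by
  obtain ⟨i, rfl⟩ : ∃ j, i = j + 1 := ⟨i - 1, by omega⟩
  let φ : N →ₗ[R] N := x • LinearMap.id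
  have hφ : ∀ m, φ ^ m = x ^ m • LinearMap.id := by
    intro m
    simp only [φ, smul_pow]
    congr 1
    exact one_pow m
  obtain ⟨k, hk⟩ := monotone_stabilizes_iff_noetherian.2 (inferInstance : IsNoetherian R N)
    (LinearMap.iterateKer φ)
  let T := LinearMap.ker (φ ^ k)
  refine V.mid (SES.of_sub T) ?_ ?_
  · refine V.nil (k := k) ?_ (hV _ (by omega) T)
    rintro ⟨y, hy⟩
    refine Subtype.ext ?_
    simpa [T, hφ] using hy
  · refine V.reg (x := x) (Submodule.mem_sup_right (Ideal.mem_span_singleton_self x)) ?_ ?_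
    · rw [injective_iff_map_eq_zero]
      intro y hy
      obtain ⟨y, rfl⟩ := Submodule.mkQ_surjective _ y
      have h1 : T.mkQ (x • y) = 0 := hy
      rw [← LinearMap.mem_ker, Submodule.ker_mkQ] at h1
      rw [← LinearMap.mem_ker, Submodule.ker_mkQ]
      have h2 : y ∈ LinearMap.ker (φ ^ (k+1)) := by
        rw [LinearMap.mem_ker, hφ]
        have : (φ ^ k) (x • y) = 0 := h1
        rw [hφ] at this
        simpa [pow_succ, mul_smul, smul_comm x] using this
      have := hk (k+1) (by omega)
      change LinearMap.ker (φ ^ k) = LinearMap.ker (φ ^ (k+1)) at this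
      change y ∈ LinearMap.ker (φ ^ k)
      rw [this]; exact h2
    · refine V.nil (k := 1) ?_ (hV _ (by omega) _)
      intro y
      obtain ⟨y, rfl⟩ := Submodule.mkQ_surjective _ y
      rw [← map_smul, ← LinearMap.mem_ker, Submodule.ker_mkQ, pow_one]
      exact ⟨y, rfl⟩

lemma V.bdd [IsNoetherianRing R] (a : Ideal R) : ∃ r : ℕ, ∀ i, r ≤ i →
    ∀ (N : Type u) [AddCommGroup N] [Module R N] [Module.Finite R N], V a i N := by
  classical
  obtain ⟨S, rfl⟩ := (isNoetherianRing_iff_ideal_fg R).1 inferInstance a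
  induction S using Finset.induction_on with
  | empty =>
    refine ⟨1, fun i hi N _ _ _ J hJ e => ⟨⊥, bot_le, by simp, ?_⟩⟩
    obtain ⟨i, rfl⟩ : ∃ j, i = j + 1 := ⟨i - 1, by omega⟩
    have : Module.Projective R (R ⧸ (⊥ : Ideal R)) :=
      Module.Projective.of_equiv (Submodule.quotEquivOfEqBot (⊥ : Ideal R) rfl).symm
    exact EE_projective _
  | insert x S hx ih =>
    obtain ⟨r, hr⟩ := ih
    refine ⟨r+1, fun i hi N _ _ _ => ?_⟩
    have := V.step x r hr i hi N
    rw [Finset.coe_insert, Ideal.span_insert, sup_comm]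
    exact this

end vv

section dd

lemma EE_sub_left {A B : Type u} [AddCommGroup A] [Module R A] [AddCommGroup B]
  [Module R B] {n : ℕ} [Subsingleton A] (e : EE R A B n) : e = 0 := by
  rw [← one_smul R e]; exact smul_of_ann_left _ (fun _ => Subsingleton.elim _ _) e

lemma EE_sub_right {A B : Type u} [AddCommGroup A] [Module R A] [AddCommGroup B]
  [Module R B] {n : ℕ} [Subsingleton B] (e : EE R A B n) : e = 0 := by
  rw [← one_smul R e]; exact smul_of_ann_right _ (fun _ => Subsingleton.elim _ _) e

lemma V.sub {a : Ideal R} {i : ℕ} (N : Type u) [AddCommGroup N] [Module R N] [Subsingleton N] :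
    V a i N := fun J hJ e => ⟨J, le_rfl, hJ, EE_sub_right _⟩

def cm (I : Ideal R) (x : R) :
    (R ⧸ (Submodule.colon I (↑(Ideal.span {x}) : Set R) : Ideal R)) →ₗ[R] (R ⧸ I) :=
  Submodule.mapQ _ _ (x • LinearMap.id) (by
    intro y hy
    have := Ideal.mem_colon_span_singleton.1 hy
    simpa [mul_comm] using this)

lemma cm_mk (I : Ideal R) (x y : R) :
  cm I x (Ideal.Quotient.mk _ y) = Ideal.Quotient.mk _ (x * y) := rfl

lemma ses_colon (I : Ideal R) (x : R) :
    SES (cm I x) (qm (le_sup_left : I ≤ I ⊔ Ideal.span {x})) := by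
  refine ⟨?_, ?_, qm_surj _⟩
  · rw [injective_iff_map_eq_zero]
    intro y hy
    obtain ⟨y, rfl⟩ := Ideal.Quotient.mk_surjective y
    rw [cm_mk, Ideal.Quotient.eq_zero_iff_mem, mul_comm] at hy
    exact Ideal.Quotient.eq_zero_iff_mem.2 (Ideal.mem_colon_span_singleton.2 hy)
  · have h := (ses_pow I x).ex
    intro y
    rw [h y]
    constructor
    · rintro ⟨⟨_, z, rfl⟩, rfl⟩
      obtain ⟨z, rfl⟩ := Ideal.Quotient.mk_surjective z
      exact ⟨Ideal.Quotient.mk _ z, rfl⟩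
    · rintro ⟨z, rfl⟩
      obtain ⟨z, rfl⟩ := Ideal.Quotient.mk_surjective z
      exact ⟨⟨_, Ideal.Quotient.mk _ z, rfl⟩, rfl⟩

lemma minres (q : Ideal R) [q.IsPrime] (M : Type u) [AddCommGroup M] [Module R M]
    [Module.Finite R M] : ∃ (n : ℕ) (f : (Fin n → R) →ₗ[R] M),
      (∃ s, s ∉ q ∧ ∀ m, s • m ∈ LinearMap.range f) ∧ ∀ z, f z = 0 → ∀ i, z i ∈ q := by
  classical
  have hex : ∃ (n : ℕ), ∃ (f : (Fin n → R) →ₗ[R] M), (∃ s, s ∉ q ∧ ∀ m, s • m ∈ LinearMap.range f) := by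
    obtain ⟨n, f, hf⟩ := Module.Finite.exists_fin' R M
    exact ⟨n, f, 1, fun h => (Ideal.IsPrime.ne_top ‹_›) ((Ideal.eq_top_iff_one q).2 h), fun m => by
      rw [LinearMap.range_eq_top.2 hf]; trivial⟩
  obtain ⟨f, s, hs, hf⟩ := Nat.find_spec hex
  have hmin := fun m => Nat.find_min hex (m := m)
  generalize Nat.find hex = n at f hmin hf
  refine ⟨n, f, ⟨s, hs, hf⟩, ?_⟩
  intro z hz i
  by_contra hi
  obtain ⟨k, rfl⟩ : ∃ k, n = k + 1 := ⟨n - 1, by have := i.2; omega⟩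
  refine hmin k (by omega) ⟨f ∘ₗ Function.ExtendByZero.linearMap R i.succAbove, s * z i,
    fun h => (Ideal.IsPrime.mem_or_mem ‹_› h).elim hs hi, fun m => ?_⟩
  obtain ⟨w, hw⟩ := hf m
  refine ⟨fun j => (z i • w - w i • z) (i.succAbove j), ?_⟩
  have h1 : Function.ExtendByZero.linearMap R i.succAbove
      (fun j => (z i • w - w i • z) (i.succAbove j)) = z i • w - w i • z := by
    ext j
    rcases Fin.eq_self_or_eq_succAbove i j with rfl | ⟨j, rfl⟩
    · rw [Function.ExtendByZero.linearMap_apply]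
      rw [Function.extend_apply' _ _ _ (by rintro ⟨x, hx⟩; exact Fin.succAbove_ne _ _ hx)]
      simp [mul_comm]
    · rw [Function.ExtendByZero.linearMap_apply]
      rw [(Fin.succAbove_right_injective).extend_apply]
  rw [LinearMap.comp_apply, h1, map_sub, map_smul, map_smul, hz, hw, smul_zero, sub_zero, smul_smul,
    mul_comm]

lemma exists_map (q : Ideal R) [hq : q.IsPrime] (M : Type u) [AddCommGroup M] [Module R M]
    [Module.Finite R M] (hM : Module.annihilator R M = ⊥) : ∃ φ : M →ₗ[R] (R ⧸ q), φ ≠ 0 := by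
  obtain ⟨n, f, ⟨s, hs, hf⟩, hker⟩ := minres q M
  have hn : n ≠ 0 := by
    rintro rfl
    apply hs
    have : s ∈ Module.annihilator R M := by
      rw [Module.mem_annihilator]
      intro m
      obtain ⟨w, hw⟩ := hf m
      rw [← hw, Subsingleton.elim w 0, map_zero]
    rw [hM] at this
    rw [(Submodule.mem_bot R).1 this]; exact q.zero_mem
  let i : Fin n := ⟨0, by omega⟩
  let c : (Fin n → R) →ₗ[R] (R ⧸ q) := Submodule.mkQ q ∘ₗ LinearMap.proj i
  have hc : LinearMap.ker f ≤ LinearMap.ker c := by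
    intro z hz
    rw [LinearMap.mem_ker]
    exact Ideal.Quotient.eq_zero_iff_mem.2 (hker z hz i)
  let g : LinearMap.range f →ₗ[R] (R ⧸ q) :=
    (Submodule.liftQ _ c hc) ∘ₗ f.quotKerEquivRange.symm.toLinearMap
  have hg : ∀ z, g ⟨f z, z, rfl⟩ = c z := by
    intro z
    have : f.quotKerEquivRange.symm ⟨f z, z, rfl⟩ = (LinearMap.ker f).mkQ z := by
      rw [LinearEquiv.symm_apply_eq]; rfl
    change (Submodule.liftQ _ c hc) (f.quotKerEquivRange.symm ⟨f z, z, rfl⟩) = _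
    rw [this, Submodule.mkQ_apply, Submodule.liftQ_apply]
  refine ⟨g ∘ₗ (s • LinearMap.id : M →ₗ[R] M).codRestrict _ hf, fun h0 => ?_⟩
  have h1 := LinearMap.congr_fun h0 (f (Pi.single i 1))
  have h2 : (s • LinearMap.id : M →ₗ[R] M).codRestrict _ hf (f (Pi.single i 1)) =
      (⟨f (s • Pi.single i 1), s • Pi.single i 1, rfl⟩ : LinearMap.range f) := by
    apply Subtype.ext; simp
  rw [LinearMap.comp_apply, h2, hg] at h1
  apply hs
  have h3 : Ideal.Quotient.mk q ((s • (Pi.single i 1 : Fin n → R)) i) = 0 := h1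
  rw [Ideal.Quotient.eq_zero_iff_mem] at h3
  simpa using h3

lemma V.descend [IsNoetherianRing R] {a : Ideal R} {i : ℕ}
    (h1 : ∀ (N : Type u) [AddCommGroup N] [Module R N] [Module.Finite R N], V a (i+1) N)
    (M : Type u) [AddCommGroup M] [Module R M]
    [Module.Finite R M] (hM : Module.annihilator R M = ⊥) (hV : V a i M)
    (N : Type u) [AddCommGroup N] [Module R N] [Module.Finite R N] : V a i N := by
  have key : ∀ I : Ideal R, V a i (R ⧸ I) := by
    have oka : Ideal.IsOka (fun I : Ideal R => V a i (R ⧸ I)) := by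
      constructor
      · have : Subsingleton (R ⧸ (⊤ : Ideal R)) := Submodule.Quotient.subsingleton_iff.2 rfl
        exact V.sub _
      · intro I x hx hc
        exact V.mid (ses_colon I x) hc hx
    by_contra! hcon
    obtain ⟨P, hP⟩ := exists_maximal_of_wellFoundedGT _ hcon
    have hpr := oka.isPrime_of_maximal_not hP
    obtain ⟨φ, hφ⟩ := exists_map P M hM
    let K := LinearMap.range φ
    have hK : V a i K := V.right (SES.of_surj φ.rangeRestrict φ.surjective_rangeRestrict) (h1 _) hV
    let J : Ideal R := K.comap (Submodule.mkQ P)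
    have hPJ : P ≤ J := by
      intro y hy
      change Ideal.Quotient.mk P y ∈ K
      rw [Ideal.Quotient.eq_zero_iff_mem.2 hy]; exact K.zero_mem
    have hJ : V a i (R ⧸ J) := by
      by_contra hJ
      have hJP := hP.2 hJ hPJ
      apply hφ
      ext m
      have : φ m ∈ K := ⟨m, rfl⟩
      obtain ⟨y, hy⟩ := Ideal.Quotient.mk_surjective (φ m)
      rw [← hy] at this
      have := hJP (show y ∈ J from this)
      rw [← hy]
      exact Ideal.Quotient.eq_zero_iff_mem.2 this
    refine hP.1 (V.mid (f := K.subtype) (g := qm hPJ) ⟨K.injective_subtype, ?_, qm_surj _⟩ hK hJ)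
    intro y
    obtain ⟨y, rfl⟩ := Ideal.Quotient.mk_surjective y
    rw [qm_mk, Ideal.Quotient.eq_zero_iff_mem]
    constructor
    · intro h
      exact ⟨⟨_, h⟩, rfl⟩
    · rintro ⟨⟨z, hz⟩, rfl : z = _⟩
      exact hz
  refine IsNoetherianRing.induction_on_isQuotientEquivQuotientPrime R
    (motive := fun N _ _ _ => V a i N) ‹_› ?_ ?_ ?_
  · intro N _ _ _ _; exact V.sub N
  · intro N _ _ _ p e; exact (key p.1).equiv e.symm
  · intro N₁ _ _ _ N₂ _ _ _ N₃ _ _ _ f g hf hg hfg hh1 hh3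
    exact V.mid ⟨hf, hfg, hg⟩ hh1 hh3

lemma G1 [IsNoetherianRing R] {a : Ideal R} {N : Type u} [AddCommGroup N] [Module R N] {g : ℕ}
    (h : ∀ j, j < g → ∀ e : EE R (R ⧸ a) N j, e = 0) :
    ∀ j, j < g → ∀ (L : Type u) [AddCommGroup L] [Module R L] [Module.Finite R L],
      a ≤ (Module.annihilator R L).radical → ∀ e : EE R L N j, e = 0 := by
  intro j
  induction j using Nat.strong_induction_on with
  | _ j ih =>
  intro hj L _ _ _
  refine IsNoetherianRing.induction_on_isQuotientEquivQuotientPrime R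
    (motive := fun L _ _ _ => a ≤ (Module.annihilator R L).radical → ∀ e : EE R L N j, e = 0)
      ‹_› ?_ ?_ ?_
  · intro L _ _ _ _ _ e; exact EE_sub_left e
  · intro L _ _ _ p φ ha e
    have hp := p.2
    rw [φ.annihilator_eq, Ideal.annihilator_quotient, hp.radical] at ha
    suffices H : ∀ e : EE R (R ⧸ p.asIdeal) N j, e = 0 from
      pre_equiv_inj φ.symm e (H _)
    clear e
    intro e
    have s := SES.of_surj (qm ha) (qm_surj ha)
    have h0 := h j hj (pre (qm ha) e)
    cases j with
    | zero => exact s.con0 _ h0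
    | succ j =>
      obtain ⟨f, rfl⟩ := s.con3 _ h0
      rw [ih j (by omega) (by omega) _ ?_ f, map_zero]
      refine le_trans ?_ Ideal.le_radical
      refine le_trans (le_of_eq ?_) (LinearMap.annihilator_le_of_injective _ s.inj)
      exact (Ideal.annihilator_quotient).symm
  · intro N₁ _ _ _ N₂ _ _ _ N₃ _ _ _ f g hf hg hfg hh1 hh3 ha e
    have s : SES f g := ⟨hf, hfg, hg⟩
    obtain ⟨e', rfl⟩ := s.con2 e (hh1 (ha.trans (Ideal.radical_mono
      (LinearMap.annihilator_le_of_injective _ s.inj))) _)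
    rw [hh3 (ha.trans (Ideal.radical_mono
      (LinearMap.annihilator_le_of_surjective _ s.surj))) e', map_zero]

lemma G2 [IsNoetherianRing R] {a : Ideal R} {N : Type u} [AddCommGroup N] [Module R N] {g : ℕ}
    (h : ∀ j, j < g → ∀ e : EE R (R ⧸ a) N j, e = 0) (e : EE R (R ⧸ a) N g) (he : e ≠ 0) :
    ¬ V a g N := by
  intro hV
  obtain ⟨J, hJ, hr, h0⟩ := hV a Ideal.le_radical e
  apply he
  have s := SES.of_surj (qm hJ) (qm_surj hJ)
  cases g with
  | zero => exact s.con0 _ h0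
  | succ j =>
    obtain ⟨f, rfl⟩ := s.con3 _ h0
    rw [G1 h j (by omega) _ ?_ f, map_zero]
    refine hr.trans (Ideal.radical_mono ?_)
    refine le_trans (le_of_eq ?_) (LinearMap.annihilator_le_of_injective _ s.inj)
    exact (Ideal.annihilator_quotient).symm

lemma G3 [IsNoetherianRing R] {a : Ideal R} {N : Type u} [AddCommGroup N] [Module R N]
    (h : ∀ j, ∀ e : EE R (R ⧸ a) N j, e = 0) (i : ℕ) : V a i N := by
  intro J hJ e
  refine ⟨J, le_rfl, hJ, ?_⟩
  rw [G1 (g := i+1) (fun j _ => h j) i (by omega) _ ?_ e, map_zero]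
  rwa [Ideal.annihilator_quotient]

end dd

section ee

def LZ (q : Ideal R) (E : Type*) [AddCommGroup E] [Module R E] : Prop :=
  ∀ e : E, ∃ s, s ∉ q ∧ s • e = 0

variable {q : Ideal R} [hq : q.IsPrime] {M X N : Type u} [AddCommGroup M] [Module R M]
  [AddCommGroup X] [Module R X] [AddCommGroup N] [Module R N]

lemma nmul {s t : R} (hs : s ∉ q) (ht : t ∉ q) : s * t ∉ q :=
  fun h => (hq.mem_or_mem h).elim hs ht

lemma coker_kill {M' : Submodule R M} {s : R} (h : ∀ m : M, s • m ∈ M') (y : M ⧸ M') :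
    s • y = 0 := by
  obtain ⟨y, rfl⟩ := Submodule.mkQ_surjective _ y
  rw [← map_smul, ← LinearMap.mem_ker, Submodule.ker_mkQ]
  exact h y

lemma T1 {M' : Submodule R M} {s : R} (h : ∀ m : M, s • m ∈ M') {j : ℕ}
    (e : EE R X M' j) (he : post M'.subtype e = 0) : s • e = 0 := by
  have s2 := SES.of_sub M'
  cases j with
  | zero => rw [s2.cov0 e he, smul_zero]
  | succ j =>
    obtain ⟨c, rfl⟩ := s2.cov1 e he
    rw [← map_smul, smul_of_ann_right s (coker_kill h) c, map_zero]

lemma T1' {M' : Submodule R M} {s : R} (hs : s ∉ q) (h : ∀ m : M, s • m ∈ M') {j : ℕ}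
    (hL : LZ q (EE R X M j)) : LZ q (EE R X M' j) := by
  intro e
  obtain ⟨t, ht, h0⟩ := hL (post M'.subtype e)
  rw [← map_smul] at h0
  exact ⟨s * t, nmul hs ht, by rw [mul_smul, T1 h _ h0]⟩

lemma T2 {M' : Submodule R M} {s : R} (hs : s ∉ q) (h : ∀ m : M, s • m ∈ M') {j : ℕ}
    (hL : LZ q (EE R M N j)) : LZ q (EE R M' N j) := by
  intro e
  have s2 := SES.of_sub M'
  have h1 : s2.dcon (s • e) = 0 := by
    rw [map_smul]; exact smul_of_ann_left s (coker_kill h) _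
  obtain ⟨e', he'⟩ := s2.con1 _ h1
  obtain ⟨t, ht, h0⟩ := hL e'
  exact ⟨t * s, nmul ht hs, by rw [mul_smul, ← he', ← map_smul, h0, map_zero]⟩

lemma T3 {F : Type u} [AddCommGroup F] [Module R F] {f : F →ₗ[R] M} {s u : R} (hs : s ∉ q)
    (h : ∀ m : M, s • m ∈ LinearMap.range f) (hu : u ∉ q) (hk : ∀ z, f z = 0 → u • z = 0) {j : ℕ}
    (e : EE R X F j) (he : post f e = 0) : ∃ t, t ∉ q ∧ t • e = 0 := by
  have h1 : post (LinearMap.range f).subtype (post f.rangeRestrict e) = 0 := by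
    rw [post_post]; exact he
  have h2 := T1 h _ h1
  rw [← map_smul] at h2
  have s1 := SES.of_surj f.rangeRestrict f.surjective_rangeRestrict
  obtain ⟨e', he'⟩ := s1.cov2 _ h2
  refine ⟨u * s, nmul hu hs, ?_⟩
  rw [mul_smul, ← he', ← map_smul, smul_of_ann_right u _ e', map_zero]
  rintro ⟨z, hz⟩
  apply Subtype.ext
  refine hk z ?_
  rw [LinearMap.ker_rangeRestrict] at hz
  exact hz

lemma cayley [IsNoetherianRing R] {Z : Type u} [AddCommGroup Z] [Module R Z] [Module.Finite R Z]
    {t : R} (ht : t ∉ q) (h : ∀ z : Z, t • z ∈ q • (⊤ : Submodule R Z)) :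
    ∃ u, u ∉ q ∧ ∀ z : Z, u • z = 0 := by
  obtain ⟨P, hm, -, hc, h0⟩ := LinearMap.exists_monic_and_natDegree_eq_and_coeff_mem_pow_and_aeval_eq_zero
    R (algebraMap R (Module.End R Z) t) q (by rintro _ ⟨z, rfl⟩; exact h z)
  rw [Polynomial.aeval_algebraMap_apply] at h0
  refine ⟨P.eval t, ?_, fun z => ?_⟩
  · intro hmem
    apply ht
    apply hq.mem_of_pow_mem P.natDegree
    rw [Polynomial.eval_eq_sum_range, Finset.sum_range_succ, hm.coeff_natDegree, one_mul] at hmem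
    refine (Ideal.add_mem_iff_right _ ?_).1 hmem
    refine Ideal.sum_mem _ fun k hk => Ideal.mul_mem_right _ _ ?_
    exact Ideal.pow_le_self (by have := Finset.mem_range.1 hk; omega) (hc k)
  · have := LinearMap.congr_fun h0 z
    simpa using this

lemma EE_zero_rep (e : EE R M N 0) : ∃ ρ : M →ₗ[R] N, e = Abelian.Ext.mk₀ (ModuleCat.ofHom ρ) := by
  obtain ⟨f, rfl⟩ := (Abelian.Ext.mk₀_bijective _ _).2 e
  exact ⟨f.hom, rfl⟩

lemma post_free_zero {n : ℕ} {j : ℕ} (h : ∀ e : EE R X R j, e = 0) (e : EE R X (Fin n → R) j) :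
    e = 0 := by
  classical
  rw [← post_id e]
  have : (LinearMap.id : (Fin n → R) →ₗ[R] (Fin n → R)) =
      ∑ i : Fin n, (LinearMap.single R (fun _ : Fin n => R) i) ∘ₗ LinearMap.proj i := by
    refine LinearMap.ext fun x => ?_
    funext k
    simp [Pi.single_apply]
  rw [this, post_sum]
  refine Finset.sum_eq_zero fun i _ => ?_
  rw [← post_post, h (post (LinearMap.proj i) e), map_zero]

lemma post_q_zero {n : ℕ} {j : ℕ} (φ : R →ₗ[R] (Fin n → R)) (h : ∀ i, φ 1 i ∈ q)
    (e : EE R (R ⧸ q) R j) : post φ e = 0 := by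
  classical
  have : φ = ∑ i : Fin n, φ 1 i • (LinearMap.single R (fun _ : Fin n => R) i) := by
    refine LinearMap.ext_ring ?_
    funext k
    simp [Pi.single_apply]
  rw [this, post_sum]
  refine Finset.sum_eq_zero fun i _ => ?_
  rw [post_smul]
  refine smul_of_ann_left _ ?_ _
  intro y
  obtain ⟨y, rfl⟩ := Ideal.Quotient.mk_surjective y
  exact Ideal.Quotient.eq_zero_iff_mem.2 (q.mul_mem_right y (h i))

lemma ann_of_zero [IsNoetherianRing R] {n : ℕ} {f : (Fin n → R) →ₗ[R] M}
    {s : R} (hs : s ∉ q) (h : ∀ m : M, s • m ∈ LinearMap.range f) (hker : ∀ z, f z = 0 → ∀ i, z i ∈ q)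
    (hL : LZ q (EE R (LinearMap.range f) (LinearMap.ker f.rangeRestrict) 1)) :
    ∃ u, u ∉ q ∧ ∀ z, f z = 0 → u • z = 0 := by
  classical
  let Z := LinearMap.ker f.rangeRestrict
  have s1 := SES.of_surj f.rangeRestrict f.surjective_rangeRestrict
  let e : EE R Z Z 0 := Abelian.Ext.mk₀ (ModuleCat.ofHom LinearMap.id)
  obtain ⟨t, ht, h0⟩ := hL (s1.dcon e)
  rw [← map_smul] at h0
  obtain ⟨r, hr⟩ := s1.con1 _ h0
  obtain ⟨ρ, rfl⟩ := EE_zero_rep r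
  have h1 : t • e = Abelian.Ext.mk₀ (ModuleCat.ofHom (t • (LinearMap.id : Z →ₗ[R] Z))) := by
    have : ModuleCat.ofHom (t • (LinearMap.id : Z →ₗ[R] Z)) = t • ModuleCat.ofHom LinearMap.id := rfl
    rw [this, Abelian.Ext.mk₀_smul]
  rw [h1, pre_apply, Abelian.Ext.mk₀_comp_mk₀] at hr
  have hr := (Abelian.Ext.mk₀_bijective _ _).1 hr
  rw [← ModuleCat.ofHom_comp] at hr
  have hr := congrArg ModuleCat.Hom.hom hr
  have hmem : ∀ z : LinearMap.ker f.rangeRestrict, f z.1 = 0 := by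
    rintro ⟨z, hz⟩
    rw [LinearMap.ker_rangeRestrict] at hz
    exact hz
  obtain ⟨u, hu, hu'⟩ := cayley (q := q) (Z := LinearMap.ker f.rangeRestrict) ht (by
    intro z
    have h2 : ρ z.1 = t • z := LinearMap.congr_fun hr z
    rw [← h2]
    have h3 : z.1 = ∑ i, z.1 i • (Pi.single i 1 : Fin n → R) := by
      funext k; simp [Pi.single_apply]
    rw [h3, map_sum]
    refine Submodule.sum_mem _ fun i _ => ?_
    rw [map_smul]
    exact Submodule.smul_mem_smul (hker _ (hmem z) i) trivial)
  refine ⟨u, hu, fun z hz => ?_⟩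
  exact congrArg Subtype.val (hu' ⟨z, by rw [LinearMap.ker_rangeRestrict]; exact hz⟩)

lemma Smain [IsNoetherianRing R] {g : ℕ} (H1 : ∀ j, j < g → ∀ e : EE R (R ⧸ q) R j, e = 0)
    (e0 : EE R (R ⧸ q) R g) (he0 : ∀ s, s ∉ q → s • e0 ≠ 0) (p : ℕ) :
    ∀ (M : Type u) [AddCommGroup M] [Module R M] [Module.Finite R M]
    (_ : ∀ (N : Type u) [AddCommGroup N] [Module R N] [Module.Finite R N], LZ q (EE R M N (p+1)))
    (n : ℕ) (f : (Fin n → R) →ₗ[R] M) (s : R) (_ : s ∉ q) (_ : ∀ m : M, s • m ∈ LinearMap.range f)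
    (_ : ∀ z, f z = 0 → ∀ i, z i ∈ q), (∃ u, u ∉ q ∧ ∀ z, f z = 0 → u • z = 0) ∨
      ∃ j, j < g ∧ ¬ LZ q (EE R (R ⧸ q) M j) := by
  classical
  induction p with
  | zero =>
    intro M _ _ _ hM n f s hs hf hker
    exact Or.inl (ann_of_zero hs hf hker (T2 hs hf (hM _)))
  | succ p ih =>
    intro M _ _ _ hM n f s hs hf hker
    by_contra hcon
    push Not at hcon
    obtain ⟨hc1, hc2⟩ := hcon
    have s1 := SES.of_surj f.rangeRestrict f.surjective_rangeRestrict
    have hmem : ∀ z : LinearMap.ker f.rangeRestrict, f z.1 = 0 := by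
      rintro ⟨z, hz⟩
      rw [LinearMap.ker_rangeRestrict] at hz
      exact hz
    have star : ∀ j, j ≤ g → ∀ e : EE R (R ⧸ q) (LinearMap.ker f.rangeRestrict) j,
        post (LinearMap.ker f.rangeRestrict).subtype e = 0 → ∃ t, t ∉ q ∧ t • e = 0 := by
      intro j hj e he
      cases j with
      | zero => exact ⟨1, fun h => hq.ne_top ((Ideal.eq_top_iff_one q).2 h), by
          rw [s1.cov0 e he, smul_zero]⟩
      | succ j =>
        obtain ⟨c, rfl⟩ := s1.cov1 e he
        obtain ⟨t, ht, h0⟩ := T1' hs hf (hc2 j (by omega)) c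
        exact ⟨t, ht, by rw [← map_smul, h0, map_zero]⟩
    have hZ : ∀ (N : Type u) [AddCommGroup N] [Module R N] [Module.Finite R N],
        LZ q (EE R (LinearMap.ker f.rangeRestrict) N (p+1)) := by
      intro N _ _ _ e
      obtain ⟨t, ht, h0⟩ := T2 hs hf (hM N) (s1.dcon e)
      rw [← map_smul] at h0
      obtain ⟨e', he'⟩ := s1.con1 _ h0
      exact ⟨t, ht, by rw [← he', EE_projective e', map_zero]⟩
    obtain ⟨n', f', ⟨s', hs', hf'⟩, hker'⟩ := minres q (LinearMap.ker f.rangeRestrict)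
    rcases ih _ hZ n' f' s' hs' hf' hker' with ⟨u, hu, hu'⟩ | ⟨j, hj, hj'⟩
    · have hn : n' ≠ 0 := by
        rintro rfl
        obtain ⟨z, hz, hz'⟩ := hc1 s' hs'
        obtain ⟨w, hw⟩ := hf' ⟨z, by rw [LinearMap.ker_rangeRestrict]; exact hz⟩
        apply hz'
        have := congrArg Subtype.val hw
        rw [Subsingleton.elim w 0, map_zero] at this
        exact this.symm
      let i : Fin n' := ⟨0, by omega⟩
      let e1 := post (LinearMap.single R (fun _ : Fin n' => R) i) e0
      have h1 : post (LinearMap.ker f.rangeRestrict).subtype (post f' e1) = 0 := by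
        rw [post_post, post_post]
        refine post_q_zero _ ?_ e0
        intro k
        exact hker _ (hmem _) k
      obtain ⟨t, ht, h2⟩ := star g le_rfl _ h1
      rw [← map_smul] at h2
      obtain ⟨v, hv, h3⟩ := T3 hs' hf' hu hu' _ h2
      refine he0 (v * t) (nmul hv ht) ?_
      have h4 := congrArg (post (LinearMap.proj i : (Fin n' → R) →ₗ[R] R)) h3
      rw [map_zero, smul_smul, map_smul, post_post] at h4
      have : (LinearMap.proj i : (Fin n' → R) →ₗ[R] R) ∘ₗ LinearMap.single R (fun _ : Fin n' => R) i
          = LinearMap.id := by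
        refine LinearMap.ext_ring ?_
        simp
      rwa [this, post_id] at h4
    · exact hj' fun e => star j hj.le e (post_free_zero (H1 j hj) _)

lemma grade_le [IsNoetherianRing R] {a : Ideal R} {g c p : ℕ}
    (h1 : ∀ j, j < g → ∀ e : EE R (R ⧸ a) R j, e = 0) (e : EE R (R ⧸ a) R g) (he : e ≠ 0)
    (M : Type u) [AddCommGroup M] [Module R M] [Module.Finite R M]
    (hM : Module.annihilator R M = ⊥)
    (hpd : ∀ (N : Type u) [AddCommGroup N] [Module R N], ∀ e : EE R M N (p+1), e = 0)
    (hc : ∀ j, j < c → ∀ e : EE R (R ⧸ a) M j, e = 0) : c ≤ g := by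
  classical
  have oka : Ideal.IsOka (fun I : Ideal R => a ≤ I → ∀ e : EE R (R ⧸ I) R g, e = 0) := by
    constructor
    · have : Subsingleton (R ⧸ (⊤ : Ideal R)) := Submodule.Quotient.subsingleton_iff.2 rfl
      exact fun _ e => EE_sub_left e
    · intro I x hx hc ha e
      have ss := ses_colon I x
      obtain ⟨e', rfl⟩ := ss.con2 e (hc (ha.trans (fun y hy =>
        Ideal.mem_colon_span_singleton.2 (I.mul_mem_right _ hy))) _)
      rw [hx (ha.trans le_sup_left) e', map_zero]
  have hex : ∃ I : Ideal R, ¬ (a ≤ I → ∀ e : EE R (R ⧸ I) R g, e = 0) :=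
    ⟨a, fun h => he (h le_rfl e)⟩
  obtain ⟨q, hqm⟩ := exists_maximal_of_wellFoundedGT _ hex
  have hq : q.IsPrime := oka.isPrime_of_maximal_not hqm
  have hq1 := hqm.1
  push Not at hq1
  obtain ⟨haq, e0, he0⟩ := hq1
  have he0' : ∀ s, s ∉ q → s • e0 ≠ 0 := by
    intro s hs h0
    have ss : SES (s • (LinearMap.id : (R ⧸ q) →ₗ[R] (R ⧸ q)))
        (qm (le_sup_left : q ≤ q ⊔ Ideal.span {s})) := by
      refine ⟨?_, ?_, qm_surj _⟩
      · rw [injective_iff_map_eq_zero]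
        intro y hy
        obtain ⟨y, rfl⟩ := Ideal.Quotient.mk_surjective y
        have hy' : Ideal.Quotient.mk q (s * y) = 0 := hy
        rw [Ideal.Quotient.eq_zero_iff_mem] at hy' ⊢
        exact (hq.mem_or_mem hy').resolve_left hs
      · intro y
        rw [(ses_pow q s).ex y]
        constructor
        · rintro ⟨⟨_, z, rfl⟩, rfl⟩
          exact ⟨z, rfl⟩
        · rintro ⟨z, rfl⟩
          exact ⟨⟨_, z, rfl⟩, rfl⟩
    obtain ⟨e', h'⟩ := ss.con2 e0 (by rw [pre_smul, pre_id, h0])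
    apply he0
    rw [← h']
    by_contra hne
    have h5 : ¬ (a ≤ q ⊔ Ideal.span {s} → ∀ e : EE R (R ⧸ (q ⊔ Ideal.span {s})) R g, e = 0) := by
      intro h
      rw [h (haq.trans le_sup_left) e', map_zero] at hne
      exact hne rfl
    exact hs (hqm.2 h5 le_sup_left (Submodule.mem_sup_right (Ideal.mem_span_singleton_self s)))
  have hann : a ≤ (Module.annihilator R (R ⧸ q)).radical := by
    rw [Ideal.annihilator_quotient]; exact haq.trans Ideal.le_radical
  have H1 : ∀ j, j < g → ∀ e : EE R (R ⧸ q) R j, e = 0 := fun j hj => G1 h1 j hj _ hann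
  have Hc : ∀ j, j < c → ∀ e : EE R (R ⧸ q) M j, e = 0 := fun j hj => G1 hc j hj _ hann
  have hone : (1 : R) ∉ q := fun h => hq.ne_top ((Ideal.eq_top_iff_one q).2 h)
  obtain ⟨n, f, ⟨s, hs, hf⟩, hker⟩ := minres q M
  by_contra hgc
  rcases Smain H1 e0 he0' p M (fun N _ _ _ e => ⟨1, hone, by rw [hpd N e, smul_zero]⟩) n f s hs hf
    hker with ⟨u, hu, hu'⟩ | ⟨j, hj, hj'⟩
  · have hn : n ≠ 0 := by
      rintro rfl
      apply hs
      have : s ∈ Module.annihilator R M := by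
        rw [Module.mem_annihilator]
        intro m
        obtain ⟨w, hw⟩ := hf m
        rw [← hw, Subsingleton.elim w 0, map_zero]
      rw [hM] at this
      rw [(Submodule.mem_bot R).1 this]; exact q.zero_mem
    let i : Fin n := ⟨0, by omega⟩
    let e1 := post (LinearMap.single R (fun _ : Fin n => R) i) e0
    obtain ⟨v, hv, h3⟩ := T3 hs hf hu hu' e1 (Hc g (by omega) _)
    refine he0' v hv ?_
    have h4 := congrArg (post (LinearMap.proj i : (Fin n → R) →ₗ[R] R)) h3
    rw [map_zero, map_smul, post_post] at h4
    have : (LinearMap.proj i : (Fin n → R) →ₗ[R] R) ∘ₗ LinearMap.single R (fun _ : Fin n => R) i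
        = LinearMap.id := by
      refine LinearMap.ext_ring ?_
      simp
    rwa [this, post_id] at h4
  · exact hj' fun e => ⟨1, hone, by rw [Hc j (by omega) e, smul_zero]⟩

end ee

noncomputable abbrev lcD (a : Ideal R) (i : ℕ) (N : Type u) [AddCommGroup N] [Module R N] :
    (ℕᵒᵖ)ᵒᵖ ⥤ ModuleCat.{u} R :=
  localCohomology.diagram (localCohomology.idealPowersDiagram a) i ⋙
    (evaluation (ModuleCat.{u} R) (ModuleCat.{u} R)).obj (ModuleCat.of R N)

lemma lc_colim (a : Ideal R) (i : ℕ) (N : Type u) [AddCommGroup N] [Module R N] :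
    ∃ c : Cocone (lcD a i N), c.pt = localCoh R a i N ∧ Nonempty (IsColimit c) := by
  have := localCohomology.hasColimitDiagram.{u, 0} (localCohomology.idealPowersDiagram a) i
  refine ⟨((evaluation (ModuleCat.{u} R) (ModuleCat.{u} R)).obj (ModuleCat.of R N)).mapCocone
    (colimit.cocone (localCohomology.diagram (localCohomology.idealPowersDiagram a) i)), rfl, ⟨?_⟩⟩
  exact isColimitOfPreserves _ (colimit.isColimit _)

lemma lcD_map (a : Ideal R) (i : ℕ) (N : Type u) [AddCommGroup N] [Module R N]
    {t k : ℕ} (h : t ≤ k) (φ : op (op t) ⟶ op (op k))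
    (x : oldE (ModuleCat.of R (R ⧸ a ^ t)) (ModuleCat.of R N) i) (e : EE R (R ⧸ a ^ t) N i)
    (hx : Match x e) :
    (show oldE (ModuleCat.of R (R ⧸ a ^ k)) (ModuleCat.of R N) i from (lcD a i N).map φ x) = 0 ↔
    pre (qm (Ideal.pow_le_pow_right h : a ^ k ≤ a ^ t)) e = 0 :=
  match_zero (match_nat hx (ModuleCat.ofHom (qm (Ideal.pow_le_pow_right h : a ^ k ≤ a ^ t))))

instance lcP (a : Ideal R) (i : ℕ) (N : Type u) [AddCommGroup N] [Module R N] :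
    PreservesColimit (lcD a i N) (forget (ModuleCat.{u} R)) := by
  have : PreservesFilteredColimitsOfSize.{0, 0} (forget (ModuleCat.{u} R)) :=
    preservesFilteredColimitsOfSize_shrink.{0, u, 0, u} _
  have : IsFiltered (ℕᵒᵖ)ᵒᵖ := inferInstance
  infer_instance

lemma lc_iff [IsNoetherianRing R] (a : Ideal R) (i : ℕ) (N : Type u) [AddCommGroup N] [Module R N] :
    Nontrivial (localCoh R a i N) ↔ ¬ V a i N := by
  rw [← not_subsingleton_iff_nontrivial, not_iff_not]
  obtain ⟨c, hc, ⟨hcol⟩⟩ := lc_colim a i N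
  rw [← hc]
  constructor
  · intro hs J hJ e
    obtain ⟨t, ht⟩ := Ideal.exists_pow_le_of_le_radical_of_fg hJ (IsNoetherian.noetherian a)
    obtain ⟨x, hx⟩ := match_r (pre (qm ht) e)
    have h1 : c.ι.app (op (op t)) x = c.ι.app (op (op t)) 0 :=
      @Subsingleton.elim _ hs _ _
    obtain ⟨k, f, g, h2⟩ := (Concrete.isColimit_rep_eq_iff_exists _ hcol _ _).1 h1
    rw [map_zero] at h2
    have hk : t ≤ k.unop.unop := f.unop.unop.down.down
    have h3 := (lcD_map a i N hk f x _ hx).1 h2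
    refine ⟨a ^ k.unop.unop, (Ideal.pow_le_pow_right hk).trans ht, ?_, ?_⟩
    · intro y hy; exact ⟨_, Ideal.pow_mem_pow hy _⟩
    · rw [pre_pre, qm_qm] at h3; exact h3
  · intro hV
    refine subsingleton_of_forall_eq 0 fun x => ?_
    obtain ⟨t, y, rfl⟩ := Concrete.isColimit_exists_rep _ hcol x
    obtain ⟨e, he⟩ := match_l (X := ModuleCat.of R (R ⧸ a ^ t.unop.unop)) (Y := ModuleCat.of R N)
      (n := i) y
    obtain ⟨J, h, hJ, h0⟩ := hV (a ^ t.unop.unop)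
      (fun y hy => ⟨_, Ideal.pow_mem_pow hy _⟩) e
    obtain ⟨k, hk⟩ := Ideal.exists_pow_le_of_le_radical_of_fg hJ (IsNoetherian.noetherian a)
    have hm : t.unop.unop ≤ max t.unop.unop k := le_max_left _ _
    have hmk : a ^ (max t.unop.unop k) ≤ J := (Ideal.pow_le_pow_right (le_max_right _ _)).trans hk
    let φ : t ⟶ op (op (max t.unop.unop k)) := (homOfLE hm).op.op
    have h1 : (lcD a i N).map φ y = 0 := (lcD_map a i N hm φ y e he).2 (by
      have := congrArg (pre (qm hmk)) h0
      rw [pre_pre, qm_qm, map_zero] at this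
      exact this)
    have h2 := c.w φ
    rw [← h2]
    change c.ι.app _ ((lcD a i N).map φ y) = 0
    rw [h1, map_zero]

end helpers

/-- if `R` admits a faithful `a`-relative Cohen-Macaulay module of finite
projective dimension, then `R` is `a`-relative Cohen-Macaulay. -/
theorem stmt7 [IsNoetherianRing R] [Nontrivial R] (a : Ideal R) (ha : a ≠ ⊤)
    (M : Type u) [AddCommGroup M] [Module R M] [Module.Finite R M]
    (hfaith : Module.annihilator R M = ⊥)
    (hCM : IsRelCM R a M) (hpd : rpd R M ≠ ⊤) :
    rgrade R a R = rcd R a R := by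
  classical
  have hE : ∀ (N : Type u) [AddCommGroup N] [Module R N] (i : ℕ),
      Nontrivial (relExt R a i N) ↔ ∃ e : EE R (R ⧸ a) N i, e ≠ 0 := by
    intro N _ _ i
    exact nontrivial_old_iff
  have hS : ∀ (N : Type u) [AddCommGroup N] [Module R N],
      {i | Nontrivial (localCoh R a i N)} = {i | ¬ V a i N} := by
    intro N _ _
    ext i
    exact lc_iff a i N
  have hcd : rgrade R a M = rcd R a M := by
    rcases hCM with h | h
    · exfalso
      obtain ⟨r, hr, hr'⟩ := Submodule.exists_sub_one_mem_and_smul_eq_zero_of_fg_of_le_smul a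
        (⊤ : Submodule R M) Module.Finite.fg_top (le_of_eq h.symm)
      have h1 : r ∈ Module.annihilator R M := Module.mem_annihilator.2 fun m => hr' m trivial
      rw [hfaith, Submodule.mem_bot] at h1
      rw [h1, zero_sub] at hr
      exact ha ((Ideal.eq_top_iff_one a).2 (by simpa using hr))
    · exact h.2
  obtain ⟨p, hp⟩ : ∃ p : ℕ, ∀ (N : Type u) [AddCommGroup N] [Module R N],
      ∀ e : EE R M N (p+1), e = 0 := by
    obtain ⟨p, hp⟩ := ENat.ne_top_iff_exists.1 hpd
    refine ⟨p, fun N _ _ e => ?_⟩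
    by_contra he
    have h1 : ((p+1 : ℕ) : ℕ∞) ≤ rpd R M :=
      le_sSup ⟨p+1, ⟨ModuleCat.of R N, nontrivial_old_iff.2 ⟨e, he⟩⟩, rfl⟩
    rw [← hp, Nat.cast_le] at h1
    omega
  obtain ⟨r, hr⟩ := V.bdd a
  have bdd : ∀ (N : Type u) [AddCommGroup N] [Module R N] [Module.Finite R N],
      BddAbove {i | ¬ V a i N} := by
    intro N _ _ _
    refine ⟨r, fun i hi => ?_⟩
    by_contra h
    exact hi (hr i (by omega) N)
  -- descending induction
  have desc : ∀ i, (∀ j, i ≤ j → V a j M) → V a i R := by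
    intro i hi
    have key : ∀ k j, i ≤ j → r ≤ j + k →
        ∀ (N : Type u) [AddCommGroup N] [Module R N] [Module.Finite R N], V a j N := by
      intro k
      induction k with
      | zero => intro j _ hj; exact hr j (by omega)
      | succ k ih =>
        intro j hij hj
        exact V.descend (ih (j+1) (by omega) (by omega)) M hfaith (hi j hij)
    exact key r i le_rfl (by omega) R
  by_cases hne : {i | Nontrivial (relExt R a i R)}.Nonempty
  · have hmem := Nat.sInf_mem hne
    have hlt : ∀ j, j < rgrade R a R → ∀ e : EE R (R ⧸ a) R j, e = 0 := by
      intro j hj e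
      by_contra he
      exact Nat.notMem_of_lt_sInf hj ((hE R j).2 ⟨e, he⟩)
    obtain ⟨e, he⟩ := (hE R _).1 hmem
    have hg : ¬ V a (rgrade R a R) R := G2 hlt e he
    have hub : ∀ i, ¬ V a i R → {i | ¬ V a i M}.Nonempty ∧ i ≤ rcd R a M := by
      intro i hi
      have : ∃ j, i ≤ j ∧ ¬ V a j M := by
        by_contra hcon
        push Not at hcon
        exact hi (desc i hcon)
      obtain ⟨j, hij, hj⟩ := this
      refine ⟨⟨j, hj⟩, hij.trans ?_⟩
      unfold rcd
      rw [hS M]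
      exact le_csSup (bdd M) hj
    have hcM : rgrade R a M ≤ rgrade R a R := by
      refine grade_le hlt e he M hfaith hp ?_
      intro j hj e
      by_contra he
      exact Nat.notMem_of_lt_sInf hj ((hE M j).2 ⟨e, he⟩)
    apply le_antisymm
    · unfold rcd
      rw [hS R]
      exact le_csSup (bdd R) hg
    · rw [hcd] at hcM
      refine le_trans ?_ hcM
      unfold rcd
      rw [hS R]
      exact csSup_le ⟨_, hg⟩ fun i hi => (hub i hi).2
  · have h0 : ∀ j, ∀ e : EE R (R ⧸ a) R j, e = 0 := by
      intro j e
      by_contra he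
      exact hne ⟨j, (hE R j).2 ⟨e, he⟩⟩
    have h1 : {i | ¬ V a i R} = ∅ := by
      ext i
      simpa using G3 h0 i
    unfold rgrade rcd
    rw [hS R, h1, Set.not_nonempty_iff_eq_empty.1 hne, Nat.sInf_empty]
    simp
end

section
/- Let 𝔞 be an ideal of R, f : R → T a faithfully flat ring homomorphism, and M a finitely generated R-module with M ≠ 𝔞M. Then grade(𝔞,M) = grade(𝔞T, M ⊗_R T) and cd(𝔞,M) = cd(𝔞T, M ⊗_R T). -/
open CategoryTheory Opposite
open scoped TensorProduct

universe u

variable (R : Type u) [CommRing R]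

lemma alg_iff {R T : Type u} [CommRing R] [CommRing T] [Algebra R T] [Module.FaithfullyFlat R T]
    {A B C D A' B' C' D' : Type u}
    [AddCommGroup A] [AddCommGroup B] [AddCommGroup C] [AddCommGroup D]
    [AddCommMonoid A'] [AddCommMonoid B'] [AddCommMonoid C'] [AddCommMonoid D']
    [Module R A] [Module R B] [Module R C] [Module R D]
    [Module T A'] [Module T B'] [Module T C'] [Module T D']
    (δ : B →ₗ[R] C) (φ : B →ₗ[R] D) (ε : A →ₗ[R] D)
    (δ' : B' →ₗ[T] C') (φ' : B' →ₗ[T] D') (ε' : A' →ₗ[T] D')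
    (eA : T ⊗[R] A ≃ₗ[T] A') (eB : T ⊗[R] B ≃ₗ[T] B') (eC : T ⊗[R] C ≃ₗ[T] C')
    (eD : T ⊗[R] D ≃ₗ[T] D')
    (h1 : ∀ b, δ' (eB (1 ⊗ₜ b)) = eC (1 ⊗ₜ δ b)) (h2 : ∀ b, φ' (eB (1 ⊗ₜ b)) = eD (1 ⊗ₜ φ b))
    (h3 : ∀ a, ε' (eA (1 ⊗ₜ a)) = eD (1 ⊗ₜ ε a)) :
    (∀ b, δ b = 0 → ∃ a, φ b = ε a) ↔ (∀ b, δ' b = 0 → ∃ a, φ' b = ε' a) := by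
  have st : ∀ {Y : Type u} [AddCommGroup Y] [Module R Y] (t : T) (y : Y),
      t ⊗ₜ[R] y = t • ((1 : T) ⊗ₜ[R] y) := by
    intro Y _ _ t y
    rw [TensorProduct.smul_tmul', smul_eq_mul, mul_one]
  have k1 : ∀ w, δ' (eB w) = eC (δ.lTensor T w) := by
    intro w
    induction w with
    | zero => simp
    | add x y hx hy => simp only [map_add, hx, hy]
    | tmul t b => rw [LinearMap.lTensor_tmul, st t b, st t (δ b), map_smul, map_smul, map_smul, h1]
  have k3 : ∀ w, ε' (eA w) = eD (ε.lTensor T w) := by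
    intro w
    induction w with
    | zero => simp
    | add x y hx hy => simp only [map_add, hx, hy]
    | tmul t b => rw [LinearMap.lTensor_tmul, st t b, st t (ε b), map_smul, map_smul, map_smul, h3]
  constructor
  · intro H b hb
    obtain ⟨w, rfl⟩ := eB.surjective b
    rw [k1, LinearEquiv.map_eq_zero_iff] at hb
    have hex := Module.Flat.lTensor_exact (R := R) T (f := (LinearMap.ker δ).subtype) (g := δ)
      (LinearMap.exact_subtype_ker_map δ)
    obtain ⟨v, rfl⟩ := (hex w).1 hb
    clear hb
    induction v with
    | zero => exact ⟨0, by simp⟩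
    | add x y hx hy =>
      obtain ⟨a, ha⟩ := hx
      obtain ⟨c, hc⟩ := hy
      exact ⟨a + c, by simp only [map_add, ha, hc]⟩
    | tmul t b =>
      obtain ⟨a, ha⟩ := H b.1 b.2
      refine ⟨t • eA (1 ⊗ₜ a), ?_⟩
      rw [LinearMap.lTensor_tmul, st, map_smul, map_smul, map_smul, h3, Submodule.subtype_apply,
        h2, ha]
  · intro H b hb
    obtain ⟨a, ha⟩ := H (eB (1 ⊗ₜ b)) (by rw [h1, hb, TensorProduct.tmul_zero, map_zero])
    obtain ⟨w, rfl⟩ := eA.surjective a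
    rw [h2, k3] at ha
    rw [eD.injective.eq_iff] at ha
    have hz : (1 : T) ⊗ₜ[R] ((LinearMap.range ε).mkQ (φ b)) = 0 := by
      have := congrArg ((LinearMap.range ε).mkQ.lTensor T) ha
      rw [LinearMap.lTensor_tmul] at this
      rw [this, ← LinearMap.comp_apply, ← LinearMap.lTensor_comp, LinearMap.range_mkQ_comp]
      simp
    rw [Module.FaithfullyFlat.one_tmul_eq_zero_iff] at hz
    obtain ⟨a, ha⟩ := (Submodule.Quotient.mk_eq_zero _).1 hz
    exact ⟨a, ha.symm⟩


section
variable (A : Type u) [CommRing A] [IsNoetherianRing A]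

lemma fg_cover (X : FGModuleCat.{u} A) : ∃ (P : FGModuleCat.{u} A) (f : P ⟶ X),
    Projective ((forget₂ (FGModuleCat.{u} A) (ModuleCat.{u} A)).obj P) ∧ Projective P ∧ Epi f := by
  obtain ⟨n, f, hf⟩ := Module.Finite.exists_fin' A X
  let P : FGModuleCat.{u} A := FGModuleCat.of A (Fin n → A)
  have hP : Projective ((forget₂ (FGModuleCat.{u} A) (ModuleCat.{u} A)).obj P) := by
    change Projective (ModuleCat.of A (Fin n → A))
    rw [← IsProjective.iff_projective]
    infer_instance
  refine ⟨P, FGModuleCat.ofHom f, hP, ?_, ?_⟩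
  · constructor
    intro E X g e he
    have : Epi ((forget₂ (FGModuleCat.{u} A) (ModuleCat.{u} A)).map e) := inferInstance
    obtain ⟨l, hl⟩ := hP.factors ((forget₂ (FGModuleCat.{u} A) (ModuleCat.{u} A)).map g)
      ((forget₂ (FGModuleCat.{u} A) (ModuleCat.{u} A)).map e)
    obtain ⟨l', rfl⟩ := (forget₂ (FGModuleCat.{u} A) (ModuleCat.{u} A)).map_surjective l
    exact ⟨l', (forget₂ (FGModuleCat.{u} A) (ModuleCat.{u} A)).map_injective (by simpa using hl)⟩
  · apply (forget₂ (FGModuleCat.{u} A) (ModuleCat.{u} A)).epi_of_epi_map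
    rw [ModuleCat.epi_iff_surjective]
    exact hf

instance fg_enough : EnoughProjectives (FGModuleCat.{u} A) where
  presentation X := by
    obtain ⟨P, f, h1, h2, h3⟩ := fg_cover A X
    exact ⟨⟨P, f⟩⟩

instance fg_pres : (forget₂ (FGModuleCat.{u} A) (ModuleCat.{u} A)).PreservesProjectiveObjects where
  projective_obj {X} hX := by
    obtain ⟨P, f, h1, h2, h3⟩ := fg_cover A X
    let r : Retract X P := ⟨Projective.factorThru (𝟙 X) f, f, by simp⟩
    exact Retract.projective (r.map (forget₂ (FGModuleCat.{u} A) (ModuleCat.{u} A)))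

lemma fg_res (X : Type u) [AddCommGroup X] [Module A X] [Module.Finite A X] :
    ∃ P : ProjectiveResolution (ModuleCat.of A X), ∀ n, Module.Finite A (P.complex.X n) := by
  let P := ProjectiveResolution.of (FGModuleCat.of A X)
  refine ⟨(forget₂ (FGModuleCat.{u} A) (ModuleCat.{u} A)).mapProjectiveResolution P, fun n => ?_⟩
  exact inferInstanceAs (Module.Finite A (P.complex.X n))
end


lemma next_down (n : ℕ) : (ComplexShape.down ℕ).next n = n - 1 := by
  cases n <;> simp

lemma homologyMap_zero_iff {A : Type u} [CommRing A]
    {K L : ChainComplex (ModuleCat.{u} A)ᵒᵖ ℕ} (ψ : K ⟶ L) (n : ℕ) :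
    HomologicalComplex.homologyMap ψ n = 0 ↔
      ∀ g : (L.X n).unop, (L.d (n+1) n).unop.hom g = 0 →
        ∃ h : (K.X (n-1)).unop, (ψ.f n).unop.hom g = (K.d n (n-1)).unop.hom h := by
  have e1 : HomologicalComplex.homologyMap ψ n = 0 ↔
      (HomologicalComplex.opcyclesMap ψ n).unop ≫ (K.homologyι n).unop = 0 := by
    rw [← cancel_mono (L.homologyι n), HomologicalComplex.homologyι_naturality,
      Limits.zero_comp, ← unop_comp]
    constructor
    · intro h; rw [h]; rfl
    · intro h; exact Quiver.Hom.unop_inj h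
  have x1 : (ShortComplex.mk (L.pOpcycles n).unop (L.d (n+1) n).unop
      (by rw [← unop_comp, L.d_pOpcycles]; rfl)).Exact := by
    have := (ShortComplex.mk (L.d (n+1) n) (L.pOpcycles n) (by simp)).exact_of_g_is_cokernel
      (L.opcyclesIsCokernel (n+1) n (by simp))
    exact this.unop
  have x2 : (ShortComplex.mk (K.fromOpcycles n (n-1)).unop (K.homologyι n).unop
      (by rw [← unop_comp, K.homologyι_comp_fromOpcycles]; rfl)).Exact := by
    have := (ShortComplex.mk (K.homologyι n) (K.fromOpcycles n (n-1)) (by simp)).exact_of_f_is_kernel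
      (K.homologyIsKernel n (n-1) (next_down n))
    exact this.unop
  rw [ShortComplex.ShortExact.moduleCat_exact_iff_function_exact] at x1 x2
  have inj : Function.Injective (K.pOpcycles n).unop.hom := by
    rw [← ModuleCat.mono_iff_injective]; infer_instance
  have q1 : ∀ z, (K.pOpcycles n).unop.hom ((HomologicalComplex.opcyclesMap ψ n).unop.hom z) =
      (ψ.f n).unop.hom ((L.pOpcycles n).unop.hom z) := by
    intro z
    have := congrArg Quiver.Hom.unop (HomologicalComplex.p_opcyclesMap ψ n)
    rw [unop_comp, unop_comp] at this
    exact congrArg (fun f => f.hom z) this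
  have q2 : ∀ h, (K.pOpcycles n).unop.hom ((K.fromOpcycles n (n-1)).unop.hom h) =
      (K.d n (n-1)).unop.hom h := by
    intro z
    have := congrArg Quiver.Hom.unop (K.p_fromOpcycles n (n-1))
    rw [unop_comp] at this
    exact congrArg (fun f => f.hom z) this
  rw [e1]
  constructor
  · intro H g hg
    obtain ⟨z, rfl⟩ := (x1 g).1 hg
    have hz := congrArg (fun f => f.hom z) H
    obtain ⟨h, hh⟩ := (x2 ((HomologicalComplex.opcyclesMap ψ n).unop.hom z)).1 hz
    refine ⟨h, ?_⟩
    rw [← q2, ← q1]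
    exact congrArg _ hh.symm
  · intro H
    ext z
    obtain ⟨h, hh⟩ := H ((L.pOpcycles n).unop.hom z) ((x1 _).2 ⟨z, rfl⟩)
    rw [← q2, ← q1] at hh
    exact (x2 _).2 ⟨h, (inj hh).symm⟩

lemma ext_map_zero_iff {A : Type u} [CommRing A] {X Z : ModuleCat.{u} A} (f : X ⟶ Z)
    (P : ProjectiveResolution X) (Q : ProjectiveResolution Z) (φ : P.complex ⟶ Q.complex)
    (comm : φ.f 0 ≫ Q.π.f 0 = P.π.f 0 ≫ f) (Y : ModuleCat.{u} A) (n : ℕ) :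
    ((Ext A (ModuleCat A) n).map f.op).app Y = 0 ↔
      ∀ g : Q.complex.X n ⟶ Y, Q.complex.d (n+1) n ≫ g = 0 →
        ∃ h : P.complex.X (n-1) ⟶ Y, φ.f n ≫ g = P.complex.d n (n-1) ≫ h := by
  let F := ((linearYoneda A (ModuleCat.{u} A)).obj Y).rightOp
  have e1 := ProjectiveResolution.isoLeftDerivedObj_hom_naturality f P Q φ comm F n
  have e2 : ((Ext A (ModuleCat A) n).map f.op).app Y = 0 ↔
      HomologicalComplex.homologyMap ((F.mapHomologicalComplex _).map φ) n = 0 := by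
    have : ((F.leftDerived n).map f).unop = 0 ↔ (F.leftDerived n).map f = 0 :=
      ⟨fun h => Quiver.Hom.unop_inj h, fun h => by rw [h]; rfl⟩
    refine Iff.trans this ?_
    rw [← cancel_mono (Q.isoLeftDerivedObj F n).hom, e1, Limits.zero_comp]
    exact Preadditive.IsIso.comp_left_eq_zero _ _
  rw [e2, homologyMap_zero_iff]
  exact Iff.rfl

section
variable (T : Type u) [CommRing T] [Algebra R T]

/-- Base change functor. -/
noncomputable def bcF : ModuleCat.{u} R ⥤ ModuleCat.{u} T where
  obj X := ModuleCat.of T (T ⊗[R] X)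
  map f := ModuleCat.ofHom (f.hom.baseChange T)
  map_id X := by
    ext1; simp
  map_comp f g := by
    ext1; simp [LinearMap.baseChange_comp]

instance : (bcF R T).Additive where
  map_add {X Y f g} := by
    ext1; exact LinearMap.baseChange_add _ _

instance : (bcF R T).PreservesProjectiveObjects where
  projective_obj {X} hX := by
    change Projective (ModuleCat.of T (T ⊗[R] X))
    rw [← IsProjective.iff_projective] at hX ⊢
    infer_instance

instance [Module.Flat R T] : (bcF R T).PreservesHomology := by
  have := ((CategoryTheory.Functor.exact_tfae (bcF R T)).out 1 2).mp (by
    intro S h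
    rw [CategoryTheory.ShortComplex.ShortExact.moduleCat_exact_iff_function_exact] at h ⊢
    exact Module.Flat.lTensor_exact T h)
  exact this


lemma l_iff {A : Type u} [CommRing A] {P₁ Q₂ Q₁ Q₀ Y : ModuleCat.{u} A}
      (d : Q₁ ⟶ Q₂) (p : Q₀ ⟶ Q₂) (e : Q₀ ⟶ P₁) :
      (∀ g : Q₂ ⟶ Y, d ≫ g = 0 → ∃ h : P₁ ⟶ Y, p ≫ g = e ≫ h) ↔
      (∀ g : Q₂ →ₗ[A] Y, d.hom.lcomp A Y g = 0 → ∃ h : P₁ →ₗ[A] Y,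
        p.hom.lcomp A Y g = e.hom.lcomp A Y h) := by
  constructor
  · intro H g hg
    obtain ⟨h, hh⟩ := H (ModuleCat.ofHom g) (by ext1; exact hg)
    exact ⟨h.hom, congrArg ModuleCat.Hom.hom hh⟩
  · intro H g hg
    obtain ⟨h, hh⟩ := H g.hom (congrArg ModuleCat.Hom.hom hg)
    exact ⟨ModuleCat.ofHom h, by ext1; exact hh⟩

variable {R T} in
lemma hom_bc' [Module.FaithfullyFlat R T] {P₁ Q₂ Q₁ Q₀ M : Type u}
    [AddCommGroup P₁] [AddCommGroup Q₂] [AddCommGroup Q₁] [AddCommGroup Q₀] [AddCommGroup M]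
    [Module R P₁] [Module R Q₂] [Module R Q₁] [Module R Q₀] [Module R M]
    [Module.FinitePresentation R P₁] [Module.FinitePresentation R Q₂]
    [Module.FinitePresentation R Q₁] [Module.FinitePresentation R Q₀]
    (d : Q₁ →ₗ[R] Q₂) (p : Q₀ →ₗ[R] Q₂) (e : Q₀ →ₗ[R] P₁) :
    (∀ g : Q₂ →ₗ[R] M, d.lcomp R M g = 0 → ∃ h : P₁ →ₗ[R] M, p.lcomp R M g = e.lcomp R M h) ↔
    (∀ g : T ⊗[R] Q₂ →ₗ[T] T ⊗[R] M, (d.baseChange T).lcomp T (T ⊗[R] M) g = 0 →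
      ∃ h : T ⊗[R] P₁ →ₗ[T] T ⊗[R] M,
        (p.baseChange T).lcomp T (T ⊗[R] M) g = (e.baseChange T).lcomp T (T ⊗[R] M) h) := by
  have b1 := (Module.FinitePresentation.isBaseChange_map R P₁ M T)
  have b2 := (Module.FinitePresentation.isBaseChange_map R Q₂ M T)
  have b3 := (Module.FinitePresentation.isBaseChange_map R Q₁ M T)
  have b4 := (Module.FinitePresentation.isBaseChange_map R Q₀ M T)
  have c1 : ∀ x, b1.equiv (1 ⊗ₜ x) = x.baseChange T := fun x => by
    rw [IsBaseChange.equiv_tmul, one_smul]; rfl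
  have c2 : ∀ x, b2.equiv (1 ⊗ₜ x) = x.baseChange T := fun x => by
    rw [IsBaseChange.equiv_tmul, one_smul]; rfl
  have c3 : ∀ x, b3.equiv (1 ⊗ₜ x) = x.baseChange T := fun x => by
    rw [IsBaseChange.equiv_tmul, one_smul]; rfl
  have c4 : ∀ x, b4.equiv (1 ⊗ₜ x) = x.baseChange T := fun x => by
    rw [IsBaseChange.equiv_tmul, one_smul]; rfl
  refine alg_iff (R := R) (T := T)
    (d.lcomp R M) (p.lcomp R M) (e.lcomp R M)
    ((d.baseChange T).lcomp T (T ⊗[R] M)) ((p.baseChange T).lcomp T (T ⊗[R] M))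
    ((e.baseChange T).lcomp T (T ⊗[R] M)) b1.equiv b2.equiv b3.equiv b4.equiv ?_ ?_ ?_
  · intro b
    rw [c2, c3]
    exact (LinearMap.baseChange_comp _ _).symm
  · intro b
    rw [c2, c4]
    exact (LinearMap.baseChange_comp _ _).symm
  · intro b
    rw [c1, c4]
    exact (LinearMap.baseChange_comp _ _).symm

variable {R T} in
lemma hom_bc [Module.FaithfullyFlat R T] {P₁ Q₂ Q₁ Q₀ : ModuleCat.{u} R}
    [Module.FinitePresentation R P₁] [Module.FinitePresentation R Q₂]
    [Module.FinitePresentation R Q₁] [Module.FinitePresentation R Q₀]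
    (d : Q₁ ⟶ Q₂) (p : Q₀ ⟶ Q₂) (e : Q₀ ⟶ P₁) (M : Type u) [AddCommGroup M] [Module R M] :
      (∀ g : Q₂ ⟶ ModuleCat.of R M, d ≫ g = 0 → ∃ h : P₁ ⟶ ModuleCat.of R M, p ≫ g = e ≫ h) ↔
      (∀ g : (bcF R T).obj Q₂ ⟶ ModuleCat.of T (T ⊗[R] M), (bcF R T).map d ≫ g = 0 →
        ∃ h : (bcF R T).obj P₁ ⟶ ModuleCat.of T (T ⊗[R] M),
          (bcF R T).map p ≫ g = (bcF R T).map e ≫ h) := by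
  rw [l_iff, l_iff]
  exact hom_bc' d.hom p.hom e.hom

lemma lift_comm {A : Type u} [CommRing A] {X Z : ModuleCat.{u} A} (f : X ⟶ Z)
    (P : ProjectiveResolution X) (Q : ProjectiveResolution Z) :
    (ProjectiveResolution.lift f P Q).f 0 ≫ Q.π.f 0 = P.π.f 0 ≫ f := by
  exact ProjectiveResolution.lift_commutes_zero f P Q

variable {R T} in
lemma map_comm [Module.Flat R T] {X Z : ModuleCat.{u} R} (f : X ⟶ Z)
    (P : ProjectiveResolution X) (Q : ProjectiveResolution Z) (φ : P.complex ⟶ Q.complex)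
    (comm : φ.f 0 ≫ Q.π.f 0 = P.π.f 0 ≫ f) :
    (((bcF R T).mapHomologicalComplex _).map φ).f 0 ≫
      ((bcF R T).mapProjectiveResolution Q).π.f 0 =
      ((bcF R T).mapProjectiveResolution P).π.f 0 ≫ (bcF R T).map f := by
  have h : (bcF R T).map (φ.f 0) ≫ (bcF R T).map (Q.π.f 0) =
      (bcF R T).map (P.π.f 0) ≫ (bcF R T).map f := by
    rw [← Functor.map_comp, comm]
    exact (bcF R T).map_comp _ _
  have e : ∀ {W : ModuleCat.{u} R} (S : ProjectiveResolution W),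
    ((bcF R T).mapProjectiveResolution S).π.f 0 = (bcF R T).map (S.π.f 0) := by
    intro W S
    simp
    exact Category.comp_id _
  rw [e, e]
  exact h

variable {R T} in
lemma ext_bc [IsNoetherianRing R] [Module.FaithfullyFlat R T]
    {X Z : Type u} [AddCommGroup X] [Module R X] [AddCommGroup Z] [Module R Z]
    [Module.Finite R X] [Module.Finite R Z] (f : ModuleCat.of R X ⟶ ModuleCat.of R Z)
    (M : Type u) [AddCommGroup M] [Module R M] (n : ℕ) :
    ((Ext R (ModuleCat R) n).map f.op).app (ModuleCat.of R M) = 0 ↔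
    ((Ext T (ModuleCat T) n).map ((bcF R T).map f).op).app (ModuleCat.of T (T ⊗[R] M)) = 0 := by
  obtain ⟨P, hP⟩ := fg_res R X
  obtain ⟨Q, hQ⟩ := fg_res R Z
  have hPp : ∀ n, Module.FinitePresentation R (P.complex.X n) := fun n =>
    Module.finitePresentation_of_finite R _
  have hQp : ∀ n, Module.FinitePresentation R (Q.complex.X n) := fun n =>
    Module.finitePresentation_of_finite R _
  refine (ext_map_zero_iff f P Q _ (lift_comm f P Q) _ n).trans ?_
  refine Iff.trans ?_ (ext_map_zero_iff ((bcF R T).map f) ((bcF R T).mapProjectiveResolution P)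
      ((bcF R T).mapProjectiveResolution Q) _
      (map_comm (T := T) f P Q _ (lift_comm f P Q)) _ n).symm
  exact hom_bc (T := T) (Q.complex.d (n+1) n) ((ProjectiveResolution.lift f P Q).f n)
    (P.complex.d n (n-1)) M
end

lemma ext_fin {A : Type u} [CommRing A] [IsNoetherianRing A] (X M : Type u) [AddCommGroup X]
    [Module A X] [Module.Finite A X] [AddCommGroup M] [Module A M] [Module.Finite A M] (n : ℕ) :
    Module.Finite A (((Ext A (ModuleCat.{u} A) n).obj (op (ModuleCat.of A X))).obj
      (ModuleCat.of A M)) := by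
  obtain ⟨P, hP⟩ := fg_res A X
  let F := ((linearYoneda A (ModuleCat.{u} A)).obj (ModuleCat.of A M)).rightOp
  let K := (F.mapHomologicalComplex (ComplexShape.down ℕ)).obj P.complex
  let e : ((F.leftDerived n).obj (ModuleCat.of A X)).unop ≅ (K.homology n).unop :=
    (P.isoLeftDerivedObj F n).symm.unop
  have f0 : Module.Finite A (K.X n).unop := by
    change Module.Finite A (P.complex.X n ⟶ ModuleCat.of A M)
    have := hP n
    have : Module.Finite A (P.complex.X n →ₗ[A] M) := inferInstance
    exact Module.Finite.equiv (ModuleCat.homLinearEquiv (S := A)).symm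
  have f1 : Module.Finite A (K.opcycles n).unop := by
    refine Module.Finite.of_injective (K.pOpcycles n).unop.hom ?_
    rw [← ModuleCat.mono_iff_injective]; infer_instance
  have f2 : Module.Finite A (K.homology n).unop := by
    refine Module.Finite.of_surjective (K.homologyι n).unop.hom ?_
    rw [← ModuleCat.epi_iff_surjective]; infer_instance
  exact Module.Finite.equiv e.symm.toLinearEquiv

/-- Transition map. -/
noncomputable def tr {A : Type u} [CommRing A] {I J : Ideal A} (h : I ≤ J) :
    ModuleCat.of A (A ⧸ I) ⟶ ModuleCat.of A (A ⧸ J) :=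
  ModuleCat.ofHom (Submodule.mapQ _ _ LinearMap.id h)

lemma colim_iff {A : Type u} [CommRing A] {J : Type} [SmallCategory J] [IsFiltered J]
    (G : J ⥤ ModuleCat.{u} A) (hG : ∀ j, Module.Finite A (G.obj j)) (c : Limits.Cocone G)
    (hc : Limits.IsColimit c) :
    Subsingleton c.pt ↔ ∀ j, ∃ (k : J) (f : j ⟶ k), G.map f = 0 := by
  have := Limits.preservesFilteredColimitsOfSize_shrink.{0, u, 0, u} (forget (ModuleCat.{u} A))
  have := Limits.PreservesFilteredColimitsOfSize.preserves_filtered_colimits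
    (F := forget (ModuleCat.{u} A)) J
  have hc' := Limits.isColimitOfPreserves (forget (ModuleCat.{u} A)) hc
  constructor
  · intro H j
    obtain ⟨s, hs⟩ := (hG j).fg_top
    have key : ∀ s : Finset (G.obj j), ∃ (k : J) (f : j ⟶ k), ∀ x ∈ s, (G.map f).hom x = 0 := by
      classical
      intro s
      induction s using Finset.induction_on with
      | empty => exact ⟨j, 𝟙 j, by simp⟩
      | insert a s ha ih =>
        obtain ⟨k, f, hf⟩ := ih
        have h0 : (c.ι.app j).hom a = (c.ι.app j).hom 0 := H.elim _ _
        obtain ⟨l, g, hg⟩ := (Limits.Types.FilteredColimit.isColimit_eq_iff' hc' a 0).1 h0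
        have hg' : (G.map g).hom a = 0 := by
          have : (G.map g).hom a = (G.map g).hom 0 := hg
          rw [this, map_zero]
        obtain ⟨m, p, q, hpq⟩ := IsFilteredOrEmpty.cocone_objs k l
        let r := IsFiltered.coeq (f ≫ IsFiltered.leftToMax k l) (g ≫ IsFiltered.rightToMax k l)
        let w := IsFiltered.coeqHom (f ≫ IsFiltered.leftToMax k l) (g ≫ IsFiltered.rightToMax k l)
        have hw := IsFiltered.coeq_condition (f ≫ IsFiltered.leftToMax k l)
          (g ≫ IsFiltered.rightToMax k l)
        refine ⟨r, f ≫ IsFiltered.leftToMax k l ≫ w, ?_⟩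
        intro x hx
        rcases Finset.mem_insert.1 hx with rfl | hx
        · rw [← Category.assoc, hw]
          simp [hg']
        · simp [hf x hx]
    obtain ⟨k, f, hf⟩ := key s
    refine ⟨k, f, ?_⟩
    ext1
    exact LinearMap.ext_on hs hf
  · intro H
    refine ⟨fun x y => ?_⟩
    have : ∀ x : c.pt, x = 0 := by
      intro x
      obtain ⟨j, z, hz⟩ := Limits.Types.jointly_surjective _ hc' x
      obtain ⟨k, f, hf⟩ := H j
      have e1 : (c.ι.app j).hom z = x := hz
      rw [← e1, ← c.w f, hf]
      simp
    rw [this x, this y]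

lemma lc_iff_s8 {A : Type u} [CommRing A] [IsNoetherianRing A] (a : Ideal A) (n : ℕ) (M : Type u)
    [AddCommGroup M] [Module A M] [Module.Finite A M] :
    Subsingleton ((localCohomology a n).obj (ModuleCat.of A M)) ↔ ∀ t, ∃ s, ∃ h : t ≤ s,
      ((Ext A (ModuleCat.{u} A) n).map (tr (Ideal.pow_le_pow_right (I := a) h)).op).app
        (ModuleCat.of A M) = 0 := by
  let D := localCohomology.diagram (localCohomology.idealPowersDiagram a) n
  let ev := (evaluation (ModuleCat.{u} A) (ModuleCat.{u} A)).obj (ModuleCat.of A M)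
  have := localCohomology.hasColimitDiagram.{u, 0} (localCohomology.idealPowersDiagram a) n
  have hc := Limits.isColimitOfPreserves ev (Limits.colimit.isColimit D)
  refine (colim_iff (D ⋙ ev) ?_ _ hc).trans ?_
  · intro j
    let I : Ideal A := a ^ j.unop.unop
    have hI : Module.Finite A (A ⧸ I) := inferInstance
    have h := ext_fin (A := A) (A ⧸ I) M n
    exact h
  · constructor
    · intro H t
      obtain ⟨k, f, hf⟩ := H (op (op t))
      exact ⟨k.unop.unop, f.unop.unop.le, hf⟩
    · intro H j
      obtain ⟨s, h, hs⟩ := H j.unop.unop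
      exact ⟨op (op s), (homOfLE h).op.op, hs⟩

lemma ext_iso_arrow {A : Type u} [CommRing A] {X Z X' Z' : ModuleCat.{u} A} (f : X ⟶ Z)
    (g : X' ⟶ Z') (e : X ≅ X') (e' : Z ≅ Z') (h : f ≫ e'.hom = e.hom ≫ g)
    (Y : ModuleCat.{u} A) (n : ℕ) :
    ((Ext A (ModuleCat A) n).map f.op).app Y = 0 ↔
      ((Ext A (ModuleCat A) n).map g.op).app Y = 0 := by
  let H := Ext A (ModuleCat A) n ⋙ (evaluation (ModuleCat.{u} A) (ModuleCat.{u} A)).obj Y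
  change H.map f.op = 0 ↔ H.map g.op = 0
  have h1 : H.map e'.hom.op ≫ H.map f.op = H.map g.op ≫ H.map e.hom.op := by
    rw [← H.map_comp, ← H.map_comp, ← op_comp, ← op_comp, h]
  constructor
  · intro h0
    rw [h0, Limits.comp_zero] at h1
    rwa [← Preadditive.IsIso.comp_right_eq_zero _ (H.map e.hom.op), eq_comm]
  · intro h0
    rw [h0, Limits.zero_comp] at h1
    exact (Preadditive.IsIso.comp_left_eq_zero (H.map e'.hom.op) _).1 h1

/-- Quotient iso. -/
noncomputable def qi {A B : Type u} [CommRing A] [CommRing B] [Algebra A B] (I : Ideal A) :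
    ModuleCat.of B (B ⧸ I.map (algebraMap A B)) ≅ (bcF A B).obj (ModuleCat.of A (A ⧸ I)) :=
  (Algebra.TensorProduct.quotIdealMapEquivTensorQuot B I).toLinearEquiv.toModuleIso

lemma ext_tr {A B : Type u} [CommRing A] [CommRing B] [Algebra A B] {I J : Ideal A}
    {I' J' : Ideal B} (h : I ≤ J) (h' : I' ≤ J') (hI : I' = I.map (algebraMap A B))
    (hJ : J' = J.map (algebraMap A B)) (Y : ModuleCat.{u} B) (n : ℕ) :
    ((Ext B (ModuleCat B) n).map (tr h').op).app Y = 0 ↔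
      ((Ext B (ModuleCat B) n).map ((bcF A B).map (tr h)).op).app Y = 0 := by
  subst hI hJ
  refine ext_iso_arrow _ _ (qi I) (qi J) ?_ Y n
  ext1
  apply LinearMap.ext
  intro x
  obtain ⟨u, rfl⟩ := Ideal.Quotient.mk_surjective x
  rfl

lemma ext_tr_bc {A B : Type u} [CommRing A] [CommRing B] [Algebra A B] [IsNoetherianRing A]
    [Module.FaithfullyFlat A B] {I J : Ideal A}
    {I' J' : Ideal B} (h : I ≤ J) (h' : I' ≤ J') (hI : I' = I.map (algebraMap A B))
    (hJ : J' = J.map (algebraMap A B)) (M : Type u) [AddCommGroup M] [Module A M] (n : ℕ) :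
    ((Ext A (ModuleCat A) n).map (tr h).op).app (ModuleCat.of A M) = 0 ↔
    ((Ext B (ModuleCat B) n).map (tr h').op).app (ModuleCat.of B (B ⊗[A] M)) = 0 := by
  rw [ext_tr h h' hI hJ]
  exact ext_bc (T := B) (tr h) M n

lemma ext_sub_iff {A : Type u} [CommRing A] (I : Ideal A) (Y : ModuleCat.{u} A) (n : ℕ) :
    Subsingleton (((Ext A (ModuleCat.{u} A) n).obj (op (ModuleCat.of A (A ⧸ I)))).obj Y) ↔
      ((Ext A (ModuleCat A) n).map (tr (le_refl I)).op).app Y = 0 := by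
  have e : tr (le_refl I) = 𝟙 _ := by
    ext1
    exact Submodule.mapQ_id _
  rw [e, op_id, (Ext A (ModuleCat A) n).map_id, NatTrans.id_app, ← Limits.IsZero.iff_id_eq_zero]
  exact ModuleCat.isZero_iff_subsingleton.symm

/-- grade and cohomological dimension are preserved under faithfully flat
base change. -/
theorem stmt8 (T : Type u) [CommRing T] [IsNoetherianRing R] [IsNoetherianRing T]
    [Algebra R T] [Module.FaithfullyFlat R T]
    (a : Ideal R) (M : Type u) [AddCommGroup M] [Module R M] [Module.Finite R M]
    (hne : a • (⊤ : Submodule R M) ≠ ⊤) :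
    rgrade R a M = rgrade T (a.map (algebraMap R T)) (T ⊗[R] M) ∧
      rcd R a M = rcd T (a.map (algebraMap R T)) (T ⊗[R] M) := by
  constructor
  · refine congrArg sInf (Set.ext fun i => ?_)
    simp only [Set.mem_setOf_eq]
    rw [← not_subsingleton_iff_nontrivial, ← not_subsingleton_iff_nontrivial, not_iff_not]
    exact (ext_sub_iff a _ i).trans ((ext_tr_bc (le_refl a) (le_refl _) rfl rfl M i).trans
      (ext_sub_iff _ _ i).symm)
  · refine congrArg sSup (Set.ext fun i => ?_)
    simp only [Set.mem_setOf_eq]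
    rw [← not_subsingleton_iff_nontrivial, ← not_subsingleton_iff_nontrivial, not_iff_not]
    refine (lc_iff_s8 a i M).trans (Iff.trans ?_ (lc_iff_s8 _ i (T ⊗[R] M)).symm)
    refine forall_congr' fun t => exists_congr fun s => exists_congr fun h => ?_
    exact ext_tr_bc _ _ (Ideal.map_pow _ _ _).symm (Ideal.map_pow _ _ _).symm M i
end
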